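/- Let B ⊆ ℝⁿ, n ≥ 2, be an open ball centered at the origin. Then for each fixed t with 0 < t ≤ |B|, the supremum of u*(t) / ‖Δu‖_{L¹(B)} over all radial u ∈ W^{2,1}_{Δ,0}(B) with Δu ≠ 0 equals (1/2) N*_{|B|}(t); the same supremum taken instead over all nonnegative u ∈ W^{2,1}_{Δ,0}(B) with Δu ≠ 0 also equals (1/2) N*_{|B|}(t). -/

import Mathlib

open MeasureTheory Filter Topology
open scoped ENNReal

noncomputable section

/-- Euclidean space ℝⁿ. -/
abbrev Euc (n : ℕ) := EuclideanSpace ℝ (Fin n)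

/-- The (pointwise) Laplacian of a function on ℝⁿ: the trace of the second derivative. -/
def lapl (n : ℕ) (φ : Euc n → ℝ) (x : Euc n) : ℝ :=
  ∑ i : Fin n,
    iteratedFDeriv ℝ 2 φ x ![EuclideanSpace.single i (1 : ℝ), EuclideanSpace.single i (1 : ℝ)]

/-- A test function on Ω: smooth and compactly supported inside Ω. -/
def IsTestFun (n : ℕ) (Ω : Set (Euc n)) (φ : Euc n → ℝ) : Prop :=
  ContDiff ℝ (⊤ : ℕ∞) φ ∧ HasCompactSupport φ ∧ tsupport φ ⊆ Ω

/-- `u ∈ W₀^{1,1}(Ω)`: `u` is an L¹(Ω) limit of test functions whose gradients converge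
in L¹(Ω) (i.e. `u` is in the closure of C_c^∞(Ω) in the W^{1,1} norm). -/
def MemW0_1_1 (n : ℕ) (Ω : Set (Euc n)) (u : Euc n → ℝ) : Prop :=
  IntegrableOn u Ω volume ∧
  ∃ φ : ℕ → Euc n → ℝ, (∀ k, IsTestFun n Ω (φ k)) ∧
    Tendsto (fun k => ∫ x in Ω, |φ k x - u x|) atTop (𝓝 0) ∧
    ∃ g : Euc n → Euc n →L[ℝ] ℝ,
      IntegrableOn (fun x => ‖g x‖) Ω volume ∧
      Tendsto (fun k => ∫ x in Ω, ‖fderiv ℝ (φ k) x - g x‖) atTop (𝓝 0)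

/-- `u ∈ W^{2,1}_Δ(Ω)` with distributional Laplacian `f ∈ L¹(Ω)`. -/
def MemW21Delta (n : ℕ) (Ω : Set (Euc n)) (u f : Euc n → ℝ) : Prop :=
  MemW0_1_1 n Ω u ∧ IntegrableOn f Ω volume ∧
    ∀ ψ : Euc n → ℝ, IsTestFun n Ω ψ →
      ∫ x in Ω, u x * lapl n ψ x = ∫ x in Ω, f x * ψ x

/-- `u ∈ W^{2,1}_{Δ,0}(Ω)` with Laplacian `f`: `u` is an L¹(Ω) limit of test functions `φ k`
with `Δ(φ k) → f` in L¹(Ω) (closure of C_c^∞(Ω) in the norm ‖Δu‖₁). -/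
def MemW21Delta0 (n : ℕ) (Ω : Set (Euc n)) (u f : Euc n → ℝ) : Prop :=
  IntegrableOn u Ω volume ∧ IntegrableOn f Ω volume ∧
  ∃ φ : ℕ → Euc n → ℝ, (∀ k, IsTestFun n Ω (φ k)) ∧
    Tendsto (fun k => ∫ x in Ω, |φ k x - u x|) atTop (𝓝 0) ∧
    Tendsto (fun k => ∫ x in Ω, |lapl n (φ k) x - f x|) atTop (𝓝 0)

/-- The decreasing rearrangement `u*(t)` of `u` on Ω. -/
def decRearr (n : ℕ) (Ω : Set (Euc n)) (u : Euc n → ℝ) (t : ℝ) : ℝ :=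
  sInf {s : ℝ | 0 ≤ s ∧ volume {x ∈ Ω | s < |u x|} ≤ ENNReal.ofReal t}

/-- `‖f‖_{L¹(Ω)}`. -/
def L1norm (n : ℕ) (Ω : Set (Euc n)) (f : Euc n → ℝ) : ℝ := ∫ x in Ω, |f x|

/-- ω_{n-1}: surface measure of the unit sphere in ℝⁿ. -/
def omegaS (n : ℕ) : ℝ := 2 * Real.pi ^ ((n : ℝ) / 2) / Real.Gamma ((n : ℝ) / 2)

/-- c_n = 1/((n-2) ω_{n-1}). -/
def cConst (n : ℕ) : ℝ := 1 / (((n : ℝ) - 2) * omegaS n)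

/-- `N*_V(t)`: the rearrangement of the Green function of the ball of volume V. -/
def NstarV (n : ℕ) (V t : ℝ) : ℝ :=
  if n = 2 then (1 / (4 * Real.pi)) * Real.log (V / t)
  else cConst n * (omegaS n / (n : ℝ)) ^ (((n : ℝ) - 2) / (n : ℝ)) *
    (t ^ (-(((n : ℝ) - 2) / (n : ℝ))) - V ^ (-(((n : ℝ) - 2) / (n : ℝ))))

/-- `N*_∞(t)` (for n ≥ 3). -/
def NstarInf (n : ℕ) (t : ℝ) : ℝ :=
  cConst n * (omegaS n / (n : ℝ)) ^ (((n : ℝ) - 2) / (n : ℝ)) *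
    t ^ (-(((n : ℝ) - 2) / (n : ℝ)))

/-- The maximal function `u**(t) = (1/t) ∫₀ᵗ u*(s) ds`. -/
def maximalFn (n : ℕ) (Ω : Set (Euc n)) (u : Euc n → ℝ) (t : ℝ) : ℝ :=
  (1 / t) * ∫ s in (0:ℝ)..t, decRearr n Ω u s

/-- `u ∈ L_exp(Ω)`. -/
def MemLexp (n : ℕ) (Ω : Set (Euc n)) (u : Euc n → ℝ) : Prop :=
  ∃ M : ℝ, ∀ t : ℝ, 0 < t → t ≤ (volume Ω).toReal →
    decRearr n Ω u t / (1 + Real.log ((volume Ω).toReal / t)) ≤ M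

/-- `u ∈ L_{exp,0}(Ω)`. -/
def MemLexp0 (n : ℕ) (Ω : Set (Euc n)) (u : Euc n → ℝ) : Prop :=
  MemLexp n Ω u ∧
    Tendsto (fun t : ℝ => maximalFn n Ω u t / Real.log (1 / t)) (𝓝[>] 0) (𝓝 0)

/-- `u ∈ L^{n/(n-2),∞}(Ω)`. -/
def MemWeakL (n : ℕ) (Ω : Set (Euc n)) (u : Euc n → ℝ) : Prop :=
  ∃ M : ℝ, ∀ t : ℝ, 0 < t → t ≤ (volume Ω).toReal →
    t ^ (((n : ℝ) - 2) / (n : ℝ)) * decRearr n Ω u t ≤ M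

/-- `u ∈ L₀^{n/(n-2),∞}(Ω)`. -/
def MemWeakL0 (n : ℕ) (Ω : Set (Euc n)) (u : Euc n → ℝ) : Prop :=
  MemWeakL n Ω u ∧
    Tendsto (fun t : ℝ => t ^ (((n : ℝ) - 2) / (n : ℝ)) * maximalFn n Ω u t) (𝓝[>] 0) (𝓝 0)

/-- `Λ_n^0(Ω)`: equals `L_{exp,0}(Ω)` if n = 2 and `L₀^{n/(n-2),∞}(Ω)` if n ≥ 3. -/
def MemLambda0 (n : ℕ) (Ω : Set (Euc n)) (u : Euc n → ℝ) : Prop :=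
  if n = 2 then MemLexp0 n Ω u else MemWeakL0 n Ω u

open scoped Pointwise

/-- One-dimensional Brunn–Minkowski inequality: if `A + B ⊆ C` then `|A| + |B| ≤ |C|`. -/
lemma volume_add_le_of_add_mem {A B C : Set ℝ} (hA : MeasurableSet A) (hB : MeasurableSet B)
    (hA0 : A.Nonempty) (hB0 : B.Nonempty) (h : ∀ a ∈ A, ∀ b ∈ B, a + b ∈ C) :
    volume A + volume B ≤ volume C := by
  have key : ∀ K L : Set ℝ, K ⊆ A → L ⊆ B → IsCompact K → IsCompact L →
      volume K + volume L ≤ volume C := by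
    intro K L hK hL cK cL
    rcases K.eq_empty_or_nonempty with rfl | nK
    · obtain ⟨a, ha⟩ := hA0
      calc volume (∅ : Set ℝ) + volume L = volume ((fun x => a + x) '' L) := by
            simp
        _ ≤ volume C := measure_mono (by rintro _ ⟨x, hx, rfl⟩; exact h a ha x (hL hx))
    rcases L.eq_empty_or_nonempty with rfl | nL
    · obtain ⟨b, hb⟩ := hB0
      calc volume K + volume (∅ : Set ℝ) = volume ((fun x => x + b) '' K) := by
            simp
        _ ≤ volume C := measure_mono (by rintro _ ⟨x, hx, rfl⟩; exact h x (hK hx) b hb)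
    obtain ⟨M, hM, hM'⟩ := cK.exists_isGreatest nK
    obtain ⟨m, hm, hm'⟩ := cL.exists_isLeast nL
    have e1 : volume K = volume ((fun x => x + m) '' K) := by simp
    have e2 : volume L = volume ((fun x => M + x) '' L) := by simp
    have m2 : MeasurableSet ((fun x => M + x) '' L) :=
      (cL.image (by fun_prop)).measurableSet
    have hd : AEDisjoint volume ((fun x => x + m) '' K) ((fun x => M + x) '' L) := by
      refine measure_mono_null (t := {M + m}) ?_ (by simp)
      rintro _ ⟨⟨x, hx, rfl⟩, ⟨y, hy, hxy⟩⟩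
      have h1 := hM' hx
      have h2 := hm' hy
      simp only [Set.mem_singleton_iff] at *
      linarith
    rw [e1, e2, ← measure_union₀ m2.nullMeasurableSet hd]
    refine measure_mono (Set.union_subset ?_ ?_)
    · rintro _ ⟨x, hx, rfl⟩; exact h x (hK hx) m (hL hm)
    · rintro _ ⟨x, hx, rfl⟩; exact h M (hK hM) x (hL hx)
  rw [hA.measure_eq_iSup_isCompact, hB.measure_eq_iSup_isCompact]
  refine ENNReal.iSup_add_iSup_le fun K L => ?_
  by_cases hK : K ⊆ A ∧ IsCompact K
  · by_cases hL : L ⊆ B ∧ IsCompact L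
    · simpa [hK.1, hK.2, hL.1, hL.2] using key K L hK.1 hL.1 hK.2 hL.2
    · have : (⨆ (_ : L ⊆ B) (_ : IsCompact L), volume L) = 0 := by
        simp only [ENNReal.iSup_eq_zero]; tauto
      rw [this]
      simpa [hK.1, hK.2] using key K ∅ hK.1 (Set.empty_subset _) hK.2 isCompact_empty
  · have : (⨆ (_ : K ⊆ A) (_ : IsCompact K), volume K) = 0 := by
      simp only [ENNReal.iSup_eq_zero]; tauto
    rw [this]
    by_cases hL : L ⊆ B ∧ IsCompact L
    · simpa [hL.1, hL.2] using key ∅ L (Set.empty_subset _) hL.1 isCompact_empty hL.2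
    · have : (⨆ (_ : L ⊆ B) (_ : IsCompact L), volume L) = 0 := by
        simp only [ENNReal.iSup_eq_zero]; tauto
      simp [this]

/-- Weighted arithmetic–geometric mean inequality for extended nonnegative reals. -/
lemma ennreal_geom_mean_le {a b : ℝ} (ha : 0 < a) (hb : 0 < b) (hab : a + b = 1) (x y : ℝ≥0∞) :
    x ^ a * y ^ b ≤ ENNReal.ofReal a * x + ENNReal.ofReal b * y := by
  rcases eq_or_ne x ⊤ with rfl | hx
  · simp [ENNReal.mul_top, ha]
  rcases eq_or_ne y ⊤ with rfl | hy
  · simp [ENNReal.mul_top, hb]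
  lift x to NNReal using hx
  lift y to NNReal using hy
  lift a to NNReal using ha.le
  lift b to NNReal using hb.le
  have := NNReal.geom_mean_le_arith_mean2_weighted a b x y (by exact_mod_cast hab)
  rw [← ENNReal.coe_rpow_of_nonneg _ ha.le, ← ENNReal.coe_rpow_of_nonneg _ hb.le,
    ENNReal.ofReal_coe_nnreal, ENNReal.ofReal_coe_nnreal]
  exact_mod_cast this

/-- Superlevel-set form of the one-dimensional Prékopa–Leindler inequality, for functions with
supremum one. -/
lemma lintegral_weighted_add_le {a b : ℝ} (ha : 0 < a) (hb : 0 < b) (hab : a + b = 1)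
    {f g h : ℝ → ℝ} (hf : Measurable f) (hg : Measurable g) (hh : Measurable h)
    (f0 : ∀ x, 0 ≤ f x) (g0 : ∀ x, 0 ≤ g x) (h0 : ∀ x, 0 ≤ h x)
    (f1 : ∀ x, f x ≤ 1) (g1 : ∀ x, g x ≤ 1)
    (fs : ∀ s < 1, ∃ x, s < f x) (gs : ∀ s < 1, ∃ x, s < g x)
    (H : ∀ x y, f x ^ a * g y ^ b ≤ h (a * x + b * y)) :
    ENNReal.ofReal a * (∫⁻ x, ENNReal.ofReal (f x)) + ENNReal.ofReal b *
      (∫⁻ x, ENNReal.ofReal (g x)) ≤ ∫⁻ x, ENNReal.ofReal (h x) := by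
  rw [lintegral_eq_lintegral_meas_lt volume (Eventually.of_forall f0) hf.aemeasurable,
    lintegral_eq_lintegral_meas_lt volume (Eventually.of_forall g0) hg.aemeasurable,
    lintegral_eq_lintegral_meas_lt volume (Eventually.of_forall h0) hh.aemeasurable]
  have anti : ∀ k : ℝ → ℝ, Measurable fun t : ℝ => volume {x : ℝ | t < k x} := fun k =>
    Antitone.measurable fun s t hst => measure_mono fun x hx => lt_of_le_of_lt hst hx
  rw [← lintegral_const_mul _ (anti f), ← lintegral_const_mul _ (anti g),
    ← lintegral_add_left ((anti f).const_mul _)]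
  refine setLIntegral_mono (anti h) fun s hs => ?_
  have hs : 0 < s := hs
  rcases lt_or_ge s 1 with h1 | h1
  · have sc : ∀ (c : ℝ) (_ : 0 < c) (S : Set ℝ), ENNReal.ofReal c * volume S = volume (c • S) := by
      intro c hc S
      rw [Measure.addHaar_smul]
      simp [abs_of_pos hc]
    rw [sc a ha, sc b hb]
    obtain ⟨x₀, hx₀⟩ := fs s h1
    obtain ⟨y₀, hy₀⟩ := gs s h1
    refine volume_add_le_of_add_mem ((measurableSet_lt measurable_const hf).const_smul₀ a)
      ((measurableSet_lt measurable_const hg).const_smul₀ b)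
      ⟨a • x₀, Set.smul_mem_smul_set hx₀⟩ ⟨b • y₀, Set.smul_mem_smul_set hy₀⟩ ?_
    rintro _ ⟨x, hx, rfl⟩ _ ⟨y, hy, rfl⟩
    refine lt_of_lt_of_le ?_ (H x y)
    calc s = s ^ a * s ^ b := by rw [← Real.rpow_add hs, hab, Real.rpow_one]
      _ < f x ^ a * g y ^ b :=
        mul_lt_mul'' (Real.rpow_lt_rpow hs.le hx ha) (Real.rpow_lt_rpow hs.le hy hb)
          (by positivity) (by positivity)
  · have e1 : {x | s < f x} = ∅ := by
      ext x; simpa using (f1 x).trans h1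
    have e2 : {x | s < g x} = ∅ := by
      ext x; simpa using (g1 x).trans h1
    simp [e1, e2]

/-- One-dimensional Prékopa–Leindler inequality for bounded functions. -/
lemma prekopaLeindler_real {a b : ℝ} (ha : 0 < a) (hb : 0 < b) (hab : a + b = 1)
    {f g h : ℝ → ℝ≥0∞} (hf : Measurable f) (hg : Measurable g) (hh : Measurable h)
    {C : ℝ≥0∞} (hC : C ≠ ⊤) (fC : ∀ x, f x ≤ C) (gC : ∀ x, g x ≤ C) (hhC : ∀ x, h x ≤ C)
    (H : ∀ x y, f x ^ a * g y ^ b ≤ h (a * x + b * y)) :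
    (∫⁻ x, f x) ^ a * (∫⁻ x, g x) ^ b ≤ ∫⁻ x, h x := by
  set F := ⨆ x, f x with hF
  set G := ⨆ x, g x with hG
  have Ft : F ≠ ⊤ := ne_top_of_le_ne_top hC (iSup_le fC)
  have Gt : G ≠ ⊤ := ne_top_of_le_ne_top hC (iSup_le gC)
  rcases eq_or_ne F 0 with F0 | F0
  · have : ∀ x, f x = 0 := by simpa [hF] using F0
    simp [this, ha]
  rcases eq_or_ne G 0 with G0 | G0
  · have : ∀ x, g x = 0 := by simpa [hG] using G0
    simp [this, hb]
  set Hc : ℝ≥0∞ := F ^ a * G ^ b with hHc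
  have Fa0 : F ^ a ≠ 0 := by simp [F0, Ft]
  have Gb0 : G ^ b ≠ 0 := by simp [G0, Gt]
  have Fat : F ^ a ≠ ⊤ := ENNReal.rpow_ne_top_of_nonneg ha.le Ft
  have Gbt : G ^ b ≠ ⊤ := ENNReal.rpow_ne_top_of_nonneg hb.le Gt
  have Hc0 : Hc ≠ 0 := mul_ne_zero Fa0 Gb0
  have Hct : Hc ≠ ⊤ := ENNReal.mul_ne_top Fat Gbt
  have fl : ∀ x, f x / F ≤ 1 := fun x =>
    ENNReal.div_le_of_le_mul (by rw [one_mul]; exact le_iSup f x)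
  have gl : ∀ x, g x / G ≤ 1 := fun x =>
    ENNReal.div_le_of_le_mul (by rw [one_mul]; exact le_iSup g x)
  have ft : ∀ x, f x / F ≠ ⊤ := fun x => ne_top_of_le_ne_top ENNReal.one_ne_top (fl x)
  have gt : ∀ x, g x / G ≠ ⊤ := fun x => ne_top_of_le_ne_top ENNReal.one_ne_top (gl x)
  have htop : ∀ x, h x / Hc ≠ ⊤ := fun x =>
    ENNReal.div_ne_top (ne_top_of_le_ne_top hC (hhC x)) Hc0
  have sup1 : ∀ (k : ℝ → ℝ≥0∞) (_ : ⨆ x, k x ≠ 0) (_ : ⨆ x, k x ≠ ⊤)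
      (_ : ∀ x, k x / (⨆ x, k x) ≠ ⊤), ∀ s < 1, ∃ x, s < (k x / (⨆ x, k x)).toReal := by
    intro k k0 kt kx s hs
    rcases lt_or_ge s 0 with s0 | s0
    · exact ⟨0, s0.trans_le ENNReal.toReal_nonneg⟩
    have : ENNReal.ofReal s * (⨆ x, k x) < ⨆ x, k x := by
      conv_rhs => rw [← one_mul (⨆ x, k x)]
      exact ENNReal.mul_lt_mul_left k0 kt (by simpa using hs)
    obtain ⟨x, hx⟩ := lt_iSup_iff.1 this
    refine ⟨x, ?_⟩
    rw [← ENNReal.ofReal_lt_iff_lt_toReal s0 (kx x)]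
    rwa [ENNReal.lt_div_iff_mul_lt (Or.inl k0) (Or.inl kt)]
  have key := lintegral_weighted_add_le ha hb hab
    (f := fun x => (f x / F).toReal) (g := fun x => (g x / G).toReal)
    (h := fun x => (h x / Hc).toReal) (hf.div_const _).ennreal_toReal
    (hg.div_const _).ennreal_toReal (hh.div_const _).ennreal_toReal
    (fun _ => ENNReal.toReal_nonneg) (fun _ => ENNReal.toReal_nonneg)
    (fun _ => ENNReal.toReal_nonneg)
    (fun x => ENNReal.toReal_le_of_le_ofReal zero_le_one (by simpa using fl x))
    (fun x => ENNReal.toReal_le_of_le_ofReal zero_le_one (by simpa using gl x))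
    (sup1 f F0 Ft ft) (sup1 g G0 Gt gt) ?_
  · simp_rw [fun x => ENNReal.ofReal_toReal (ft x), fun x => ENNReal.ofReal_toReal (gt x),
      fun x => ENNReal.ofReal_toReal (htop x), div_eq_mul_inv] at key
    rw [lintegral_mul_const _ hf, lintegral_mul_const _ hg, lintegral_mul_const _ hh] at key
    have k2 := (ennreal_geom_mean_le ha hb hab _ _).trans key
    rw [ENNReal.mul_rpow_of_nonneg _ _ ha.le, ENNReal.mul_rpow_of_nonneg _ _ hb.le,
      ENNReal.inv_rpow, ENNReal.inv_rpow, mul_mul_mul_comm,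
      ← ENNReal.mul_inv (Or.inl Fa0) (Or.inl Fat)] at k2
    have k3 := mul_le_mul_left k2 Hc
    rwa [mul_assoc, ENNReal.inv_mul_cancel Hc0 Hct, mul_one, mul_assoc _ _ Hc,
      ENNReal.inv_mul_cancel Hc0 Hct, mul_one] at k3
  · intro x y
    simp only [ENNReal.toReal_rpow, ← ENNReal.toReal_mul]
    refine ENNReal.toReal_mono (htop _) ?_
    rw [ENNReal.div_rpow_of_nonneg _ _ ha.le, ENNReal.div_rpow_of_nonneg _ _ hb.le, hHc]
    simp only [div_eq_mul_inv]
    rw [mul_mul_mul_comm, ← ENNReal.mul_inv (Or.inl Fa0) (Or.inl Fat)]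
    gcongr
    exact H x y

/-- Prékopa–Leindler inequality for bounded functions supported in a ball of the sup norm. -/
lemma prekopaLeindler_pi {a b : ℝ} (ha : 0 < a) (hb : 0 < b) (hab : a + b = 1) (D : ℝ) :
    ∀ (n : ℕ) (f g h : (Fin n → ℝ) → ℝ≥0∞) (_ : Measurable f) (_ : Measurable g)
      (_ : Measurable h) (C : ℝ≥0∞) (_ : C ≠ ⊤)
      (_ : ∀ x, f x ≤ (Metric.closedBall 0 D).indicator (fun _ => C) x)
      (_ : ∀ x, g x ≤ (Metric.closedBall 0 D).indicator (fun _ => C) x)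
      (_ : ∀ x, h x ≤ (Metric.closedBall 0 D).indicator (fun _ => C) x)
      (_ : ∀ x y, f x ^ a * g y ^ b ≤ h (a • x + b • y)),
      (∫⁻ x, f x) ^ a * (∫⁻ x, g x) ^ b ≤ ∫⁻ x, h x := by
  intro n
  induction n with
  | zero =>
    intro f g h hf hg hh C hC fC gC hhC H
    have e : ∀ k : (Fin 0 → ℝ) → ℝ≥0∞, ∫⁻ x, k x = k 0 := by
      intro k
      rw [lintegral_unique, volume_pi, Measure.pi_univ]
      simp only [Finset.univ_eq_empty, Finset.prod_empty, mul_one]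
      congr 1
      exact Subsingleton.elim _ _
    rw [e, e, e]
    simpa using H 0 0
  | succ n ih =>
    intro f g h hf hg hh C hC fC gC hhC H
    let e := MeasurableEquiv.piFinSuccAbove (fun _ : Fin (n + 1) => ℝ) 0
    have he := (volume_preserving_piFinSuccAbove (fun _ : Fin (n + 1) => ℝ) 0).symm
    have esymm : ∀ x y, e.symm (x, y) = Fin.cons x y := fun x y =>
      Fin.insertNth_zero' x y
    have split : ∀ k : (Fin (n + 1) → ℝ) → ℝ≥0∞, Measurable k →
        ∫⁻ x, k x = ∫⁻ x, ∫⁻ y, k (e.symm (x, y)) := by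
      intro k hk
      rw [← he.lintegral_comp hk]
      exact lintegral_prod _ (hk.comp e.symm.measurable).aemeasurable
    have sec : ∀ k : (Fin (n + 1) → ℝ) → ℝ≥0∞,
        (∀ x, k x ≤ (Metric.closedBall 0 D).indicator (fun _ => C) x) →
        ∀ x y, k (e.symm (x, y)) ≤ (Metric.closedBall 0 D).indicator (fun _ => C) y := by
      intro k hk x y
      by_cases hy : y ∈ Metric.closedBall (0 : Fin n → ℝ) D
      · rw [Set.indicator_of_mem hy]
        exact (hk _).trans (Set.indicator_le_self _ _ _)
      · refine (hk _).trans ?_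
        rw [Set.indicator_of_notMem hy, Set.indicator_of_notMem]
        contrapose! hy
        simp only [mem_closedBall_zero_iff] at hy ⊢
        refine (pi_norm_le_iff_of_nonneg ((norm_nonneg _).trans hy)).2 fun i => ?_
        refine le_trans ?_ hy
        exact norm_le_pi_norm (e.symm (x, y)) i.succ
    have bd : ∀ k : (Fin (n + 1) → ℝ) → ℝ≥0∞,
        (∀ x, k x ≤ (Metric.closedBall 0 D).indicator (fun _ => C) x) →
        ∀ x, ∫⁻ y, k (e.symm (x, y)) ≤ C * volume (Metric.closedBall (0 : Fin n → ℝ) D) := by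
      intro k hk x
      refine (lintegral_mono (sec k hk x)).trans ?_
      rw [lintegral_indicator_const Metric.isClosed_closedBall.measurableSet]
    have me : ∀ k : (Fin (n + 1) → ℝ) → ℝ≥0∞, Measurable k →
        Measurable fun x => ∫⁻ y, k (e.symm (x, y)) := fun k hk =>
      (hk.comp e.symm.measurable).lintegral_prod_right'
    have ms : ∀ k : (Fin (n + 1) → ℝ) → ℝ≥0∞, Measurable k →
        ∀ x, Measurable fun y => k (e.symm (x, y)) := fun k hk x =>
      (hk.comp e.symm.measurable).comp measurable_prodMk_left
    rw [split f hf, split g hg, split h hh]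
    refine prekopaLeindler_real ha hb hab (me f hf) (me g hg) (me h hh)
      (ENNReal.mul_ne_top hC measure_closedBall_lt_top.ne) (bd f fC) (bd g gC) (bd h hhC) ?_
    intro x y
    refine ih _ _ _ (ms f hf x) (ms g hg y) (ms h hh _) C hC (sec f fC x) (sec g gC y)
      (sec h hhC _) ?_
    intro u v
    refine (H _ _).trans (le_of_eq ?_)
    congr 1
    simp only [esymm]
    ext i
    refine Fin.cases ?_ (fun j => ?_) i <;> simp

/-- Multiplicative Brunn–Minkowski inequality in Euclidean space. -/
lemma brunnMinkowski_mul {n : ℕ} {a b : ℝ} (ha : 0 < a) (hb : 0 < b) (hab : a + b = 1)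
    {A B C : Set (Euc n)} (hA : MeasurableSet A) (hB : MeasurableSet B) (hC : MeasurableSet C)
    (bA : Bornology.IsBounded A) (bB : Bornology.IsBounded B) (bC : Bornology.IsBounded C)
    (H : ∀ x ∈ A, ∀ y ∈ B, a • x + b • y ∈ C) :
    volume A ^ a * volume B ^ b ≤ volume C := by
  obtain ⟨D, hD⟩ := ((bA.union bB).union bC).subset_closedBall 0
  let e := (MeasurableEquiv.toLp 2 (Fin n → ℝ))
  have he : MeasurePreserving e volume volume :=
    (EuclideanSpace.volume_preserving_symm_measurableEquiv_toLp (Fin n)).symm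
  have vol : ∀ S : Set (Euc n), MeasurableSet S →
      ∫⁻ x, (e ⁻¹' S).indicator (fun _ => (1 : ℝ≥0∞)) x = volume S := by
    intro S hS
    rw [lintegral_indicator_const (e.measurable hS), one_mul,
      he.measure_preimage hS.nullMeasurableSet]
  have bd : ∀ S : Set (Euc n), S ⊆ Metric.closedBall 0 D → ∀ x,
      (e ⁻¹' S).indicator (fun _ => (1 : ℝ≥0∞)) x ≤
        (Metric.closedBall 0 D).indicator (fun _ => 1) x := by
    intro S hS x
    refine Set.indicator_le_indicator_of_subset ?_ (fun _ => zero_le) x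
    intro y hy
    have h1 := hS hy
    simp only [mem_closedBall_zero_iff] at h1 ⊢
    refine (pi_norm_le_iff_of_nonneg ((norm_nonneg _).trans h1)).2 fun i => ?_
    exact le_trans (PiLp.norm_apply_le (e y) i) h1
  rw [← vol A hA, ← vol B hB, ← vol C hC]
  refine prekopaLeindler_pi ha hb hab D n _ _ _
    (measurable_const.indicator (e.measurable hA)) (measurable_const.indicator (e.measurable hB))
    (measurable_const.indicator (e.measurable hC)) 1 ENNReal.one_ne_top
    (bd A fun x hx => hD (Or.inl (Or.inl hx))) (bd B fun x hx => hD (Or.inl (Or.inr hx)))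
    (bd C fun x hx => hD (Or.inr hx)) ?_
  intro x y
  by_cases hx : x ∈ e ⁻¹' A
  · by_cases hy : y ∈ e ⁻¹' B
    · have : a • x + b • y ∈ e ⁻¹' C := H _ hx _ hy
      simp [hx, hy, this]
    · simp [hy, hb]
  · simp [hx, ha]

/-- The isoperimetric constant `n |B₁|^{1/n}`. -/
def isoConst (n : ℕ) : ℝ := n * (volume (Metric.ball (0 : Euc n) 1)).toReal ^ (1 / (n : ℝ))

/-- Thickening form of the isoperimetric inequality. -/
lemma volume_add_isoConst_le {n : ℕ} (hn : 1 ≤ n) {E C : Set (Euc n)} (hE : MeasurableSet E)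
    (hC : MeasurableSet C) (bE : Bornology.IsBounded E) (bC : Bornology.IsBounded C)
    {ε : ℝ} (hε : 0 < ε) (h : ∀ x ∈ E, ∀ y ∈ Metric.ball (0 : Euc n) ε, x + y ∈ C)
    (hE0 : volume E ≠ 0) :
    volume E + ENNReal.ofReal (isoConst n * (volume E).toReal ^ (1 - 1 / (n : ℝ)) * ε)
      ≤ volume C := by
  have : Nonempty (Fin n) := ⟨⟨0, hn⟩⟩
  have n0 : (n : ℝ) ≠ 0 := by positivity
  set V := (volume E).toReal with hV
  set β := (volume (Metric.ball (0 : Euc n) 1)).toReal with hβ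
  have Vpos : 0 < V := ENNReal.toReal_pos hE0 bE.measure_lt_top.ne
  have βpos : 0 < β := ENNReal.toReal_pos (Metric.measure_ball_pos _ _ one_pos).ne'
    measure_ball_lt_top.ne
  set e := V ^ (1 / (n : ℝ)) with he
  set r := β ^ (1 / (n : ℝ)) * ε with hr
  have epos : 0 < e := by positivity
  have rpos : 0 < r := by positivity
  have hen : e ^ n = V := by
    rw [he, ← Real.rpow_natCast, ← Real.rpow_mul Vpos.le, one_div_mul_cancel n0, Real.rpow_one]
  have hrn : r ^ n = β * ε ^ n := by
    rw [hr, mul_pow, ← Real.rpow_natCast, ← Real.rpow_mul βpos.le, one_div_mul_cancel n0,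
      Real.rpow_one]
  have evol : volume E = ENNReal.ofReal (e ^ n) := by
    rw [hen, hV, ENNReal.ofReal_toReal bE.measure_lt_top.ne]
  have bvol : volume (Metric.ball (0 : Euc n) ε) = ENNReal.ofReal (r ^ n) := by
    rw [Measure.addHaar_ball_of_pos _ _ hε, hrn, mul_comm, ENNReal.ofReal_mul' (by positivity), hβ,
      ENNReal.ofReal_toReal measure_ball_lt_top.ne, finrank_euclideanSpace_fin]
  set a := e / (e + r) with ha
  set b := r / (e + r) with hb
  have apos : 0 < a := by positivity
  have bpos : 0 < b := by positivity
  have key := brunnMinkowski_mul (n := n) apos bpos (by rw [ha, hb]; field_simp)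
    (hE.const_smul₀ a⁻¹) (Metric.isOpen_ball.measurableSet.const_smul₀ b⁻¹) hC
    (bE.smul₀ a⁻¹) ((Metric.isBounded_ball (x := (0 : Euc n)) (r := ε)).smul₀ b⁻¹) bC (by
      rintro _ ⟨x, hx, rfl⟩ _ ⟨y, hy, rfl⟩
      simpa [smul_smul, apos.ne', bpos.ne'] using h x hx y hy)
  rw [Measure.addHaar_smul_of_nonneg _ (by positivity),
    Measure.addHaar_smul_of_nonneg _ (by positivity), evol, bvol, finrank_euclideanSpace_fin,
    ← ENNReal.ofReal_mul (by positivity), ← ENNReal.ofReal_mul (by positivity)] at key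
  have e1 : a⁻¹ ^ n * e ^ n = (e + r) ^ n := by rw [← mul_pow, ha]; congr 1; field_simp
  have e2 : b⁻¹ ^ n * r ^ n = (e + r) ^ n := by rw [← mul_pow, hb]; congr 1; field_simp
  rw [e1, e2, ← ENNReal.rpow_add _ _ (by positivity) ENNReal.ofReal_ne_top,
    show a + b = 1 by rw [ha, hb]; field_simp, ENNReal.rpow_one] at key
  refine le_trans ?_ key
  have hiso : 0 ≤ isoConst n * V ^ (1 - 1 / (n : ℝ)) * ε := by unfold isoConst; positivity
  rw [evol, ← ENNReal.ofReal_add (by positivity) hiso]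
  refine ENNReal.ofReal_le_ofReal ?_
  have e3 : V ^ (1 - 1 / (n : ℝ)) = e ^ (n - 1) := by
    rw [he, ← Real.rpow_natCast, ← Real.rpow_mul Vpos.le, Nat.cast_sub hn]
    congr 1
    field_simp
    simp
  have e4 : isoConst n * V ^ (1 - 1 / (n : ℝ)) * ε = n * e ^ (n - 1) * r := by
    rw [e3, isoConst, hr]; ring
  rw [e4]
  have := one_add_mul_le_pow (a := r / e) (by linarith [div_pos rpos epos]) n
  have h2 := mul_le_mul_of_nonneg_left this (pow_nonneg epos.le n)
  rw [← mul_pow, show e * (1 + r / e) = e + r by field_simp] at h2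
  refine le_trans (le_of_eq ?_) h2
  obtain ⟨m, rfl⟩ : ∃ m, n = m + 1 := ⟨n - 1, by omega⟩
  simp only [Nat.add_sub_cancel]
  field_simp
  ring

/-- Isoperimetric inequality for a nonnegative `C¹` function all of whose superlevel sets below
height `a` have volume at least `V`. -/
lemma isoConst_mul_le_integral_norm_fderiv {n : ℕ} (hn : 1 ≤ n) {g : Euc n → ℝ}
    (hg : ContDiff ℝ 1 g) (hc : HasCompactSupport g) (g0 : ∀ x, 0 ≤ g x) {a V : ℝ} (ha : 0 ≤ a)
    (hV : 0 < V) (hvol : ∀ s, 0 < s → s < a → V ≤ (volume {x | s < g x}).toReal) :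
    isoConst n * V ^ (1 - 1 / (n : ℝ)) * a ≤ ∫ x, ‖fderiv ℝ g x‖ := by
  have iso0 : 0 ≤ isoConst n := by unfold isoConst; positivity
  set κ := isoConst n * V ^ (1 - 1 / (n : ℝ)) with hκ
  have κ0 : 0 ≤ κ := by positivity
  have gdiff : Differentiable ℝ g := hg.differentiable one_ne_zero
  have dcont : Continuous (fderiv ℝ g) := hg.continuous_fderiv one_ne_zero
  have dsupp : HasCompactSupport (fderiv ℝ g) := hc.fderiv ℝ
  set K := Metric.cthickening 1 (tsupport g) with hK
  have cK : IsCompact K := hc.isCompact.cthickening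
  have mK : MeasurableSet K := cK.isClosed.measurableSet
  have subK : tsupport g ⊆ K := Metric.self_subset_cthickening _
  have dint : Integrable (fun x => ‖fderiv ℝ g x‖) :=
    dcont.norm.integrable_of_hasCompactSupport dsupp.norm
  have gint : Integrable g := hg.continuous.integrable_of_hasCompactSupport hc
  set vK := (volume K).toReal
  have step : ∀ δ > 0, κ * a ≤ (∫ x, ‖fderiv ℝ g x‖) + δ * vK := by
    intro δ hδ
    obtain ⟨ε₀, hε₀, huc⟩ := Metric.uniformContinuous_iff.1
      (dsupp.uniformContinuous_of_continuous dcont) δ hδ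
    set ε := min ε₀ 1 with hε
    have εpos : 0 < ε := lt_min hε₀ one_pos
    set G : Euc n → ℝ := fun x => g x + ε * K.indicator (fun x => ‖fderiv ℝ g x‖ + δ) x with hG
    have G0 : ∀ x, 0 ≤ G x := fun x => add_nonneg (g0 x) (mul_nonneg εpos.le
      (Set.indicator_nonneg (fun _ _ => by positivity) x))
    have Gm : Measurable G := hg.continuous.measurable.add
      (((dcont.norm.add continuous_const).measurable.indicator mK).const_mul ε)
    have Iint : Integrable (K.indicator fun x => ‖fderiv ℝ g x‖ + δ) :=
      ((dcont.norm.add continuous_const).continuousOn.integrableOn_compact cK).integrable_indicator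
        mK
    have Gint : Integrable G := gint.add (Iint.const_mul ε)
    have Gsub : ∀ s > 0, {x | s < G x} ⊆ K := by
      intro s hs x hx
      by_contra hxK
      have h1 : g x = 0 := image_eq_zero_of_notMem_tsupport fun h => hxK (subK h)
      have hx : s < G x := hx
      simp only [hG, h1, Set.indicator_of_notMem hxK] at hx
      linarith
    have gsub : ∀ s > 0, {x | s < g x} ⊆ K := by
      intro s hs x hx
      exact subK (subset_tsupport g (by
        have hx : s < g x := hx
        exact (hs.trans hx).ne'))
    have thick : ∀ s > 0, ∀ x ∈ {x | s < g x}, ∀ y ∈ Metric.ball (0 : Euc n) ε,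
        x + y ∈ {x | s < G x} := by
      intro s hs x hx y hy
      have hx' : s < g x := hx
      rw [mem_ball_zero_iff] at hy
      have xsupp : x ∈ tsupport g := subset_tsupport g (hs.trans hx').ne'
      have xyK : x + y ∈ K := Metric.mem_cthickening_of_dist_le _ x _ _ xsupp (by
        simpa [dist_eq_norm] using hy.le.trans (min_le_right _ _))
      have mv := (convex_ball (x + y) ε).norm_image_sub_le_of_norm_fderiv_le (𝕜 := ℝ) (f := g)
        (C := ‖fderiv ℝ g (x + y)‖ + δ) (fun z _ => gdiff z) (fun z hz => by
          have h1 := huc ((Metric.mem_ball.1 hz).trans_le (min_le_left _ _))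
          rw [dist_eq_norm] at h1
          have h2 := norm_sub_norm_le (fderiv ℝ g z) (fderiv ℝ g (x + y))
          linarith)
        (x := x + y) (y := x) (Metric.mem_ball_self εpos)
        (by simpa [dist_eq_norm] using hy)
      rw [show x - (x + y) = -y by abel, norm_neg, Real.norm_eq_abs] at mv
      have h3 : (‖fderiv ℝ g (x + y)‖ + δ) * ‖y‖ ≤ (‖fderiv ℝ g (x + y)‖ + δ) * ε := by gcongr
      have h4 := le_abs_self (g x - g (x + y))
      simp only [Set.mem_ofPred_eq, hG, Set.indicator_of_mem xyK]
      linarith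
    have level : ∀ s ∈ Set.Ioi (0 : ℝ), volume {x | s < g x} +
        (Set.Ioo 0 a).indicator (fun _ => ENNReal.ofReal (κ * ε)) s ≤ volume {x | s < G x} := by
      intro s hs
      by_cases hsa : s ∈ Set.Ioo 0 a
      · rw [Set.indicator_of_mem hsa]
        have h1 := hvol s hsa.1 hsa.2
        have h2 : volume {x | s < g x} ≠ 0 := by
          intro h; rw [h] at h1; simp at h1; linarith
        refine le_trans ?_ (volume_add_isoConst_le hn
          (measurableSet_lt measurable_const hg.continuous.measurable)
          (measurableSet_lt measurable_const Gm) (cK.isBounded.subset (gsub s hs))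
          (cK.isBounded.subset (Gsub s hs)) εpos (thick s hs) h2)
        gcongr
        rw [hκ]
        have h3 : 0 ≤ 1 - 1 / (n : ℝ) := by
          have : (1 : ℝ) ≤ n := by exact_mod_cast hn
          rw [sub_nonneg, div_le_one (by linarith)]
          exact this
        gcongr
      · rw [Set.indicator_of_notMem hsa, add_zero]
        refine measure_mono fun x hx => ?_
        simpa using thick s hs x hx 0 (Metric.mem_ball_self εpos)
    have main : ENNReal.ofReal (∫ x, g x) + ENNReal.ofReal (κ * ε) * ENNReal.ofReal a
        ≤ ENNReal.ofReal (∫ x, G x) := by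
      rw [ofReal_integral_eq_lintegral_ofReal gint (Eventually.of_forall g0),
        ofReal_integral_eq_lintegral_ofReal Gint (Eventually.of_forall G0),
        lintegral_eq_lintegral_meas_lt volume (Eventually.of_forall g0)
          hg.continuous.measurable.aemeasurable,
        lintegral_eq_lintegral_meas_lt volume (Eventually.of_forall G0) Gm.aemeasurable]
      have anti : ∀ k : Euc n → ℝ, Measurable fun t : ℝ => volume {x | t < k x} := fun k =>
        Antitone.measurable fun s t hst => measure_mono fun x hx => lt_of_le_of_lt hst hx
      have e : ENNReal.ofReal (κ * ε) * ENNReal.ofReal a = ∫⁻ s in Set.Ioi (0 : ℝ),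
          (Set.Ioo 0 a).indicator (fun _ => ENNReal.ofReal (κ * ε)) s := by
        rw [lintegral_indicator_const measurableSet_Ioo,
          Measure.restrict_apply measurableSet_Ioo,
          Set.inter_eq_left.2 (fun x hx => hx.1), Real.volume_Ioo, sub_zero]
      rw [e, ← lintegral_add_left (anti g)]
      exact setLIntegral_mono (anti G) level
    rw [← ENNReal.ofReal_mul (by positivity), ← ENNReal.ofReal_add (integral_nonneg g0)
      (by positivity), ENNReal.ofReal_le_ofReal_iff (integral_nonneg G0)] at main
    have eG : ∫ x, G x = (∫ x, g x) + ε * ∫ x in K, (‖fderiv ℝ g x‖ + δ) := by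
      rw [hG, integral_add gint (Iint.const_mul ε), integral_const_mul, integral_indicator mK]
    have eK : ∫ x in K, (‖fderiv ℝ g x‖ + δ) ≤ (∫ x, ‖fderiv ℝ g x‖) + δ * vK := by
      rw [integral_add dint.integrableOn (integrableOn_const cK.measure_lt_top.ne)]
      have := setIntegral_le_integral (s := K) dint (Eventually.of_forall fun x => norm_nonneg _)
      rw [setIntegral_const, smul_eq_mul, mul_comm (volume.real K)]
      exact add_le_add this le_rfl
    rw [eG] at main
    have : ε * (κ * a) ≤ ε * ((∫ x, ‖fderiv ℝ g x‖) + δ * vK) := by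
      nlinarith [mul_le_mul_of_nonneg_left eK εpos.le]
    exact le_of_mul_le_mul_left this εpos
  have lim : Tendsto (fun δ : ℝ => (∫ x, ‖fderiv ℝ g x‖) + δ * vK) (𝓝[>] 0)
      (𝓝 ((∫ x, ‖fderiv ℝ g x‖) + 0 * vK)) :=
    (Continuous.tendsto (by fun_prop) 0).mono_left nhdsWithin_le_nhds
  rw [zero_mul, add_zero] at lim
  exact ge_of_tendsto lim (eventually_mem_nhdsWithin.mono step)

lemma lapl_eq_sum_fderiv {n : ℕ} {φ : Euc n → ℝ} (hφ : ContDiff ℝ 2 φ) (x : Euc n) :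
    lapl n φ x = ∑ i, fderiv ℝ (fun y => fderiv ℝ φ y (EuclideanSpace.single i (1 : ℝ))) x
      (EuclideanSpace.single i (1 : ℝ)) := by
  unfold lapl
  refine Finset.sum_congr rfl fun i _ => ?_
  have hd : DifferentiableAt ℝ (fderiv ℝ φ) x :=
    ((hφ.fderiv_right (m := 1) le_rfl).differentiable one_ne_zero) x
  rw [iteratedFDeriv_two_apply, fderiv_clm_apply hd (differentiableAt_const _)]
  simp

lemma contDiff_fderiv_single {n : ℕ} {φ : Euc n → ℝ} (hφ : ContDiff ℝ 2 φ) (v : Euc n) :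
    ContDiff ℝ 1 fun y => fderiv ℝ φ y v :=
  (hφ.fderiv_right (m := 1) le_rfl).clm_apply contDiff_const

lemma continuous_lapl {n : ℕ} {φ : Euc n → ℝ} (hφ : ContDiff ℝ 2 φ) : Continuous (lapl n φ) := by
  rw [funext (lapl_eq_sum_fderiv hφ)]
  exact continuous_finsetSum _ fun i _ =>
    ((contDiff_fderiv_single hφ _).continuous_fderiv one_ne_zero).clm_apply continuous_const

lemma lapl_eq_zero_of_notMem_tsupport {n : ℕ} {φ : Euc n → ℝ} {x : Euc n}
    (hx : x ∉ tsupport φ) : lapl n φ x = 0 := by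
  have : iteratedFDeriv ℝ 2 φ x = 0 :=
    image_eq_zero_of_notMem_tsupport fun h => hx (tsupport_iteratedFDeriv_subset 2 h)
  simp [lapl, this]

lemma tsupport_lapl_subset {n : ℕ} (φ : Euc n → ℝ) : tsupport (lapl n φ) ⊆ tsupport φ :=
  closure_minimal (fun x hx => by
    by_contra h
    exact hx (lapl_eq_zero_of_notMem_tsupport h)) (isClosed_tsupport φ)

/-- Integration by parts for a directional derivative. -/
lemma integral_mul_fderiv_eq_neg {n : ℕ} {f h : Euc n → ℝ} (hf : ContDiff ℝ 1 f)
    (hh : ContDiff ℝ 1 h) (hc : HasCompactSupport f ∨ HasCompactSupport h) (v : Euc n) :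
    ∫ x, f x * fderiv ℝ h x v = -∫ x, fderiv ℝ f x v * h x := by
  have cf : Continuous fun x => fderiv ℝ f x v :=
    (hf.continuous_fderiv one_ne_zero).clm_apply continuous_const
  have ch : Continuous fun x => fderiv ℝ h x v :=
    (hh.continuous_fderiv one_ne_zero).clm_apply continuous_const
  refine integral_mul_fderiv_eq_neg_fderiv_mul_of_integrable ?_ ?_ ?_
    (fun x _ => hf.differentiable one_ne_zero x) (fun x _ => hh.differentiable one_ne_zero x)
  · refine (cf.mul hh.continuous).integrable_of_hasCompactSupport ?_
    exact hc.elim (fun k => (k.fderiv_apply ℝ v).mul_right) fun k => k.mul_left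
  · refine (hf.continuous.mul ch).integrable_of_hasCompactSupport ?_
    exact hc.elim (fun k => k.mul_right) fun k => (k.fderiv_apply ℝ v).mul_left
  · refine (hf.continuous.mul hh.continuous).integrable_of_hasCompactSupport ?_
    exact hc.elim (fun k => k.mul_right) fun k => k.mul_left

lemma integral_mul_lapl_eq_neg {n : ℕ} {f h : Euc n → ℝ} (hf : ContDiff ℝ 1 f)
    (hh : ContDiff ℝ 2 h) (hc : HasCompactSupport f ∨ HasCompactSupport h) :
    ∫ x, f x * lapl n h x = -∫ x, ∑ i, fderiv ℝ f x (EuclideanSpace.single i (1 : ℝ)) *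
      fderiv ℝ h x (EuclideanSpace.single i (1 : ℝ)) := by
  have cf : ∀ v, Continuous fun x => fderiv ℝ f x v := fun v =>
    (hf.continuous_fderiv one_ne_zero).clm_apply continuous_const
  have ch : ∀ v, ContDiff ℝ 1 fun x => fderiv ℝ h x v := contDiff_fderiv_single hh
  have chh : ∀ v, Continuous fun x => fderiv ℝ (fun y => fderiv ℝ h y v) x v := fun v =>
    ((ch v).continuous_fderiv one_ne_zero).clm_apply continuous_const
  simp_rw [lapl_eq_sum_fderiv hh, Finset.mul_sum]
  rw [integral_finsetSum, integral_finsetSum, ← Finset.sum_neg_distrib]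
  · refine Finset.sum_congr rfl fun i _ => integral_mul_fderiv_eq_neg hf (ch _) ?_ _
    exact hc.imp_right fun k => k.fderiv_apply ℝ _
  · intro i _
    refine ((cf _).mul (ch _).continuous).integrable_of_hasCompactSupport ?_
    exact hc.elim (fun k => (k.fderiv_apply ℝ _).mul_right) fun k => (k.fderiv_apply ℝ _).mul_left
  · intro i _
    refine (hf.continuous.mul (chh _)).integrable_of_hasCompactSupport ?_
    exact hc.elim (fun k => k.mul_right) fun k => ((k.fderiv_apply ℝ _).fderiv_apply ℝ _).mul_left

/-- Green's second identity for a pair of functions one of which has compact support. -/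
lemma integral_mul_lapl_comm {n : ℕ} {f h : Euc n → ℝ} (hf : ContDiff ℝ 2 f)
    (hh : ContDiff ℝ 2 h) (hc : HasCompactSupport h) :
    ∫ x, f x * lapl n h x = ∫ x, h x * lapl n f x := by
  rw [integral_mul_lapl_eq_neg (hf.of_le one_le_two) hh (Or.inr hc),
    integral_mul_lapl_eq_neg (hh.of_le one_le_two) hf (Or.inl hc)]
  simp_rw [mul_comm]

lemma norm_sq_eq_sum_single {n : ℕ} (L : Euc n →L[ℝ] ℝ) :
    ‖L‖ ^ 2 = ∑ i, L (EuclideanSpace.single i (1 : ℝ)) ^ 2 := by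
  set w := (InnerProductSpace.toDual ℝ (Euc n)).symm L with hw
  have h1 : ‖L‖ = ‖w‖ := by simp [hw]
  rw [h1, EuclideanSpace.norm_sq_eq]
  refine Finset.sum_congr rfl fun i _ => ?_
  have : L (EuclideanSpace.single i (1 : ℝ)) = w i := by
    have h2 : inner ℝ w (EuclideanSpace.single i (1 : ℝ)) = L (EuclideanSpace.single i (1 : ℝ)) :=
      InnerProductSpace.toDual_symm_apply
    rw [← h2, EuclideanSpace.inner_single_right]
    simp
  rw [this, Real.norm_eq_abs, sq_abs]

section IsTestFun

variable {n : ℕ} {Ω : Set (Euc n)} {φ : Euc n → ℝ}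

lemma IsTestFun.contDiff_two (h : IsTestFun n Ω φ) : ContDiff ℝ 2 φ :=
  contDiff_infty.1 h.1 2

lemma IsTestFun.integrable (h : IsTestFun n Ω φ) : Integrable φ :=
  h.1.continuous.integrable_of_hasCompactSupport h.2.1

lemma IsTestFun.hasCompactSupport_lapl (h : IsTestFun n Ω φ) : HasCompactSupport (lapl n φ) :=
  h.2.1.of_isClosed_subset (isClosed_tsupport _) (tsupport_lapl_subset φ)

lemma IsTestFun.integrable_lapl (h : IsTestFun n Ω φ) : Integrable (lapl n φ) :=
  (continuous_lapl h.contDiff_two).integrable_of_hasCompactSupport h.hasCompactSupport_lapl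

lemma IsTestFun.setIntegral_abs_lapl (h : IsTestFun n Ω φ) :
    ∫ x in Ω, |lapl n φ x| = ∫ x, |lapl n φ x| :=
  setIntegral_eq_integral_of_forall_compl_eq_zero fun x hx => by
    rw [lapl_eq_zero_of_notMem_tsupport fun k => hx (h.2.2 k), abs_zero]

lemma IsTestFun.integral_lapl (h : IsTestFun n Ω φ) : ∫ x, lapl n φ x = 0 := by
  have := integral_mul_lapl_eq_neg (f := fun _ => (1 : ℝ)) contDiff_const h.contDiff_two
    (Or.inr h.2.1)
  simpa using this

/-- For `0 ≤ g ≤ b`, integrating against `-Δφ` costs at most half of `b ‖Δφ‖₁`. -/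
lemma IsTestFun.neg_integral_mul_lapl_le (h : IsTestFun n Ω φ) {g : Euc n → ℝ} {b : ℝ}
    (gc : Continuous g) (g0 : ∀ x, 0 ≤ g x) (gb : ∀ x, g x ≤ b) :
    -∫ x, g x * lapl n φ x ≤ b * (1 / 2 * ∫ x, |lapl n φ x|) := by
  have lc := continuous_lapl h.contDiff_two
  have i1 : Integrable fun x => g x * lapl n φ x :=
    (gc.mul lc).integrable_of_hasCompactSupport h.hasCompactSupport_lapl.mul_left
  have e : b * (1 / 2 * ∫ x, |lapl n φ x|)
      = ∫ x, b * (1 / 2 * (|lapl n φ x| - lapl n φ x)) := by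
    rw [integral_const_mul, integral_const_mul,
      integral_sub h.integrable_lapl.abs h.integrable_lapl, h.integral_lapl, sub_zero]
  rw [e, ← integral_neg]
  refine integral_mono i1.neg
    (((h.integrable_lapl.abs.sub h.integrable_lapl).const_mul _).const_mul _) fun x => ?_
  have h0 := g0 x
  have hb := gb x
  simp only
  rcases le_total 0 (lapl n φ x) with hl | hl
  · rw [abs_of_nonneg hl]; nlinarith
  · rw [abs_of_nonpos hl]; nlinarith

end IsTestFun

lemma exists_bump_primitive {s s' ρ : ℝ} (hρ : 0 < ρ) (hρ' : ρ < (s' - s) / 2) :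
    ∃ ψ Ψ : ℝ → ℝ, Continuous ψ ∧ (∀ x, HasDerivAt Ψ (ψ x) x) ∧ (∀ x, 0 ≤ ψ x) ∧
      (∀ x, ψ x ≤ 1) ∧ (∀ x, x ∉ Set.Ioo s s' → ψ x = 0) ∧ (∀ x ≤ s, Ψ x = 0) ∧
      (∀ x ≥ s', Ψ x = Ψ s') ∧ Monotone Ψ ∧ 2 * ρ ≤ Ψ s' := by
  let ψ : ContDiffBump ((s + s') / 2 : ℝ) := ⟨ρ, (s' - s) / 2, hρ, hρ'⟩
  have hc : Continuous ψ := ψ.continuous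
  have h0 : ∀ x, x ∉ Set.Ioo s s' → ψ x = 0 := fun x hx => ψ.zero_of_le_dist (by
    rw [Real.dist_eq]
    by_contra! hlt
    rw [abs_lt] at hlt
    simp only [ψ] at hlt
    exact hx ⟨by linarith [hlt.1], by linarith [hlt.2]⟩)
  have h1 : ∀ x ∈ Set.Icc ((s + s') / 2 - ρ) ((s + s') / 2 + ρ), ψ x = 1 := fun x hx =>
    ψ.one_of_mem_closedBall (by rw [Real.closedBall_eq_Icc]; exact hx)
  have hi : ∀ a b, IntervalIntegrable ψ volume a b := fun a b => hc.intervalIntegrable a b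
  have hd : ∀ x, HasDerivAt (fun x => ∫ y in s..x, ψ y) (ψ x) x := fun x =>
    intervalIntegral.integral_hasDerivAt_right (hi _ _) (hc.stronglyMeasurableAtFilter _ _)
      hc.continuousAt
  have hm : Monotone (fun x => ∫ y in s..x, ψ y) :=
    monotone_of_deriv_nonneg (fun x => (hd x).differentiableAt) fun x => by
      rw [(hd x).deriv]; exact ψ.nonneg
  refine ⟨ψ, fun x => ∫ y in s..x, ψ y, hc, hd, fun x => ψ.nonneg, fun x => ψ.le_one, h0, ?_, ?_,
    hm, ?_⟩
  · intro x hx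
    simp only
    rw [intervalIntegral.integral_congr (g := fun _ => (0 : ℝ))]
    · simp
    · intro y hy
      rw [Set.uIcc_of_ge hx] at hy
      exact h0 y fun h => absurd h.1 (not_lt.2 hy.2)
  · intro x hx
    simp only
    rw [← intervalIntegral.integral_add_adjacent_intervals (hi s s') (hi s' x)]
    rw [intervalIntegral.integral_congr (a := s') (g := fun _ => (0 : ℝ))]
    · simp
    · intro y hy
      rw [Set.uIcc_of_le hx] at hy
      exact h0 y fun h => absurd h.2 (not_lt.2 hy.1)
  · have e1 : ∫ y in ((s + s') / 2 - ρ)..((s + s') / 2 + ρ), ψ y = 2 * ρ := by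
      rw [intervalIntegral.integral_congr (g := fun _ => (1 : ℝ))]
      · simp; ring
      · intro y hy
        rw [Set.uIcc_of_le (by linarith)] at hy
        exact h1 y hy
    have e2 := intervalIntegral.integral_add_adjacent_intervals
      (hi s ((s + s') / 2 - ρ)) (hi _ ((s + s') / 2 + ρ))
    have e3 := hm (show s ≤ (s + s') / 2 - ρ by linarith)
    have e4 := hm (show (s + s') / 2 + ρ ≤ s' by linarith)
    simp only [intervalIntegral.integral_same] at e3 e4
    linarith

lemma sq_integral_mul_le {α : Type*} [MeasurableSpace α] {μ : Measure α} {w k : α → ℝ}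
    (w0 : ∀ x, 0 ≤ w x) (i0 : Integrable w μ) (i1 : Integrable (fun x => w x * k x) μ)
    (i2 : Integrable (fun x => w x * k x ^ 2) μ) :
    (∫ x, w x * k x ∂μ) ^ 2 ≤ (∫ x, w x * k x ^ 2 ∂μ) * ∫ x, w x ∂μ := by
  have key : ∀ c : ℝ, 0 ≤ (∫ x, w x ∂μ) * (c * c) + (-2 * ∫ x, w x * k x ∂μ) * c
      + ∫ x, w x * k x ^ 2 ∂μ := fun c => by
    have : ∫ x, w x * (k x - c) ^ 2 ∂μ = (∫ x, w x ∂μ) * (c * c)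
        + (-2 * ∫ x, w x * k x ∂μ) * c + ∫ x, w x * k x ^ 2 ∂μ := by
      have e : ∀ x, w x * (k x - c) ^ 2
          = w x * (c * c) + (-2 * c) * (w x * k x) + w x * k x ^ 2 := fun x => by ring
      simp_rw [e]
      rw [integral_add (f := fun x => w x * (c * c) + -2 * c * (w x * k x))
          ((i0.mul_const _).add (i1.const_mul _)) i2,
        integral_add (i0.mul_const _) (i1.const_mul _), integral_mul_const, integral_const_mul]
      ring
    rw [← this]
    exact integral_nonneg fun x => mul_nonneg (w0 x) (sq_nonneg _)
  have := discrim_le_zero key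
  unfold discrim at this
  nlinarith

lemma IsTestFun.volume_superlevel_ne_top {n : ℕ} {Ω : Set (Euc n)} {φ : Euc n → ℝ}
    (h : IsTestFun n Ω φ) {s : ℝ} (hs : 0 ≤ s) : volume {x | s < φ x} ≠ ∞ :=
  ((measure_mono fun x (hx : s < φ x) => subset_tsupport φ (hs.trans_lt hx).ne').trans_lt
    h.2.1.isCompact.measure_lt_top).ne

/-- Quantitative decay of the distribution function of a test function between two heights. -/
lemma IsTestFun.volume_superlevel_step {n : ℕ} (hn : 2 ≤ n) {Ω : Set (Euc n)} {φ : Euc n → ℝ}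
    (h : IsTestFun n Ω φ) {s s' : ℝ} (hs : 0 ≤ s) (hss : s < s') :
    isoConst n ^ 2 * (volume {x | s' < φ x}).toReal ^ (2 - 2 / (n : ℝ)) * (s' - s) ≤
      (1 / 2 * ∫ x, |lapl n φ x|) *
        ((volume {x | s < φ x}).toReal - (volume {x | s' < φ x}).toReal) := by
  have hs' : 0 ≤ s' := hs.trans hss.le
  set m := 1 / 2 * ∫ x, |lapl n φ x| with hm
  have m0 : 0 ≤ m := mul_nonneg (by norm_num) (integral_nonneg fun x => abs_nonneg _)
  have n2 : (2 : ℝ) ≤ n := by exact_mod_cast hn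
  have dn : 2 / (n : ℝ) ≤ 1 := (div_le_one (by linarith)).2 n2
  have sub : {x | s' < φ x} ⊆ {x | s < φ x} := fun x hx => hss.trans hx
  have fin : volume {x | s < φ x} ≠ ∞ := h.volume_superlevel_ne_top hs
  have fin' : volume {x | s' < φ x} ≠ ∞ := h.volume_superlevel_ne_top hs'
  have vle : (volume {x | s' < φ x}).toReal ≤ (volume {x | s < φ x}).toReal :=
    ENNReal.toReal_mono fin (measure_mono sub)
  set V := (volume {x | s' < φ x}).toReal with hV
  have V0 : 0 ≤ V := ENNReal.toReal_nonneg
  rcases V0.eq_or_lt with hV0 | hV0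
  · rw [← hV0, Real.zero_rpow (by linarith), mul_zero, zero_mul]
    exact mul_nonneg m0 (by linarith)
  have φc : ContDiff ℝ 2 φ := h.contDiff_two
  have step : ∀ ρ, 0 < ρ → ρ < (s' - s) / 2 → isoConst n ^ 2 * V ^ (2 - 2 / (n : ℝ)) * (2 * ρ)
      ≤ m * ((volume {x | s < φ x}).toReal - V) := by
    intro ρ hρ hρ'
    obtain ⟨ψ, Ψ, ψc, Ψd, ψ0, ψ1, ψz, Ψz, Ψt, Ψm, Ψρ⟩ := exists_bump_primitive hρ hρ'
    have Ψ0 : ∀ x, 0 ≤ Ψ x := fun x => by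
      rcases le_total x s with hx | hx
      · exact (Ψz x hx).ge
      · exact (Ψz s le_rfl).ge.trans (Ψm hx)
    have Ψle : ∀ x, Ψ x ≤ Ψ s' := fun x => by
      rcases le_total x s' with hx | hx
      · exact Ψm hx
      · exact (Ψt x hx).le
    have Ψcd : ContDiff ℝ 1 Ψ := contDiff_one_iff_deriv.2
      ⟨fun x => (Ψd x).differentiableAt, by rw [funext fun x => (Ψd x).deriv]; exact ψc⟩
    have gcd : ContDiff ℝ 1 fun x => Ψ (φ x) := Ψcd.comp (φc.of_le one_le_two)
    have gcs : HasCompactSupport fun x => Ψ (φ x) := h.2.1.comp_left (g := Ψ) (Ψz 0 hs)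
    have wc : Continuous fun x => ψ (φ x) := ψc.comp h.1.continuous
    have wcs : HasCompactSupport fun x => ψ (φ x) :=
      h.2.1.comp_left (g := ψ) (ψz 0 fun k => absurd k.1 (not_lt.2 hs))
    have gd : ∀ x, fderiv ℝ (fun x => Ψ (φ x)) x = ψ (φ x) • fderiv ℝ φ x := fun x =>
      ((Ψd (φ x)).comp_hasFDerivAt x (φc.differentiable two_ne_zero x).hasFDerivAt).fderiv
    have nc : Continuous fun x => ‖fderiv ℝ φ x‖ := (φc.continuous_fderiv two_ne_zero).norm
    have iso := isoConst_mul_le_integral_norm_fderiv (by omega) gcd gcs (fun x => Ψ0 _) (Ψ0 s')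
      hV0 fun σ hσ hσa => ENNReal.toReal_mono
        ((measure_mono fun x (hx : σ < Ψ (φ x)) => (show s < φ x by
          by_contra! hle
          rw [Ψz _ hle] at hx
          exact absurd hx hσ.not_gt)).trans_lt fin.lt_top).ne
        (measure_mono fun x (hx : s' < φ x) => show σ < Ψ (φ x) by
          rw [Ψt _ hx.le]; exact hσa)
    simp_rw [gd, norm_smul, Real.norm_of_nonneg (ψ0 _)] at iso
    have cs := sq_integral_mul_le (μ := volume) (w := fun x => ψ (φ x))
      (k := fun x => ‖fderiv ℝ φ x‖) (fun x => ψ0 _) (wc.integrable_of_hasCompactSupport wcs)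
      ((wc.mul nc).integrable_of_hasCompactSupport wcs.mul_right)
      ((wc.mul (nc.pow 2)).integrable_of_hasCompactSupport wcs.mul_right)
    have J : ∫ x, ψ (φ x) * ‖fderiv ℝ φ x‖ ^ 2 ≤ Ψ s' * m := by
      refine le_trans (le_of_eq ?_) (h.neg_integral_mul_lapl_le gcd.continuous (fun x => Ψ0 _)
        fun x => Ψle _)
      rw [integral_mul_lapl_eq_neg gcd φc (Or.inr h.2.1), neg_neg]
      refine integral_congr_ae (Eventually.of_forall fun x => ?_)
      simp only [gd, norm_sq_eq_sum_single, Finset.mul_sum]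
      refine Finset.sum_congr rfl fun i _ => ?_
      simp only [_root_.smul_apply, smul_eq_mul]
      ring
    have K : ∫ x, ψ (φ x) ≤ (volume {x | s < φ x}).toReal - V := by
      have ms : MeasurableSet ({x | s < φ x} \ {x | s' < φ x}) :=
        (measurableSet_lt measurable_const h.1.continuous.measurable).diff
          (measurableSet_lt measurable_const h.1.continuous.measurable)
      have fd : volume ({x | s < φ x} \ {x | s' < φ x}) ≠ ∞ :=
        ((measure_mono Set.sdiff_subset).trans_lt fin.lt_top).ne
      calc ∫ x, ψ (φ x) ≤ ∫ x, ({x | s < φ x} \ {x | s' < φ x}).indicator (fun _ => (1 : ℝ)) x := by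
            refine integral_mono (wc.integrable_of_hasCompactSupport wcs)
              ((integrable_indicator_iff ms).2 (integrableOn_const fd)) fun x => ?_
            by_cases hx : x ∈ {x | s < φ x} \ {x | s' < φ x}
            · rw [Set.indicator_of_mem hx]; exact ψ1 _
            · rw [Set.indicator_of_notMem hx]
              exact (ψz _ fun k => hx ⟨k.1, k.2.not_gt⟩).le
        _ = (volume {x | s < φ x}).toReal - V := by
            rw [integral_indicator_const _ ms, smul_eq_mul, mul_one, Measure.real,
              measure_sdiff sub (measurableSet_lt measurable_const
                h.1.continuous.measurable).nullMeasurableSet fin',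
              ENNReal.toReal_sub_of_le (measure_mono sub) fin]
    have iso0 : 0 ≤ isoConst n := by unfold isoConst; positivity
    have a0 : 0 < Ψ s' := by linarith
    set I := ∫ x, ψ (φ x) * ‖fderiv ℝ φ x‖
    have sq1 : (isoConst n * V ^ (1 - 1 / (n : ℝ)) * Ψ s') ^ 2 ≤ I ^ 2 :=
      pow_le_pow_left₀ (by positivity) iso 2
    have e : (V ^ (1 - 1 / (n : ℝ))) ^ 2 = V ^ (2 - 2 / (n : ℝ)) := by
      rw [← Real.rpow_natCast, ← Real.rpow_mul hV0.le]; congr 1; push_cast; ring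
    have K0 : 0 ≤ ∫ x, ψ (φ x) := integral_nonneg fun x => ψ0 _
    have sq2 : I ^ 2 ≤ (Ψ s' * m) * ((volume {x | s < φ x}).toReal - V) :=
      cs.trans (mul_le_mul J K K0 (by positivity))
    have fin3 : Ψ s' * (isoConst n ^ 2 * V ^ (2 - 2 / (n : ℝ)) * Ψ s') ≤
        Ψ s' * (m * ((volume {x | s < φ x}).toReal - V)) := by
      rw [← e]; nlinarith
    have fin4 := le_of_mul_le_mul_left fin3 a0
    refine le_trans ?_ fin4
    gcongr
  have lim : Tendsto (fun ρ : ℝ => isoConst n ^ 2 * V ^ (2 - 2 / (n : ℝ)) * (2 * ρ))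
      (𝓝[<] ((s' - s) / 2)) (𝓝 (isoConst n ^ 2 * V ^ (2 - 2 / (n : ℝ)) * (2 * ((s' - s) / 2)))) :=
    (Continuous.tendsto (by fun_prop) _).mono_left nhdsWithin_le_nhds
  rw [show 2 * ((s' - s) / 2) = s' - s by ring] at lim
  refine le_of_tendsto lim ?_
  filter_upwards [Ioo_mem_nhdsLT (show 0 < (s' - s) / 2 by linarith)] with ρ hρ
  exact step ρ hρ.1 hρ.2

lemma omegaS_eq_mul_volume_ball {n : ℕ} (hn : 2 ≤ n) :
    omegaS n = n * (volume (Metric.ball (0 : Euc n) 1)).toReal := by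
  have : Nonempty (Fin n) := ⟨⟨0, by omega⟩⟩
  have n0 : (0 : ℝ) < n := by exact_mod_cast (by omega : 0 < n)
  have g0 : 0 < Real.Gamma ((n : ℝ) / 2) := Real.Gamma_pos_of_pos (by positivity)
  rw [EuclideanSpace.volume_ball, Fintype.card_fin, ENNReal.ofReal_one, one_pow, one_mul,
    ENNReal.toReal_ofReal (by positivity), Real.Gamma_add_one (by positivity), omegaS,
    Real.sqrt_eq_rpow, ← Real.rpow_natCast, ← Real.rpow_mul Real.pi_pos.le,
    show 1 / 2 * (n : ℝ) = n / 2 by ring]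
  field_simp

lemma volume_ball_one_pos (n : ℕ) : 0 < (volume (Metric.ball (0 : Euc n) 1)).toReal :=
  ENNReal.toReal_pos (Metric.measure_ball_pos _ _ one_pos).ne' measure_ball_lt_top.ne

lemma hasDerivAt_NstarV {n : ℕ} (hn : 2 ≤ n) {V τ : ℝ} (hV : 0 < V) (hτ : 0 < τ) :
    HasDerivAt (NstarV n V) (-(1 / (isoConst n ^ 2 * τ ^ (2 - 2 / (n : ℝ))))) τ := by
  set β := (volume (Metric.ball (0 : Euc n) 1)).toReal with hβ
  have β0 : 0 < β := volume_ball_one_pos n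
  have hω : omegaS n = n * β := omegaS_eq_mul_volume_ball hn
  have n0 : (0 : ℝ) < n := by exact_mod_cast (by omega : 0 < n)
  have c2 : isoConst n ^ 2 = n ^ 2 * β ^ (2 / (n : ℝ)) := by
    rw [isoConst, mul_pow, ← Real.rpow_natCast (β ^ _), ← Real.rpow_mul β0.le]
    congr 2; push_cast; ring
  by_cases h2 : n = 2
  · subst h2
    have : (4 : ℝ) * Real.pi = isoConst 2 ^ 2 := by
      rw [c2]
      have : β = Real.pi := by
        have h := hω
        simp only [omegaS, Nat.cast_ofNat, div_self (two_ne_zero (α := ℝ)), Real.rpow_one,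
          Real.Gamma_one, div_one] at h
        linarith
      rw [this]; norm_num
    have e : NstarV 2 V = fun t => 1 / (4 * Real.pi) * Real.log (V / t) := by
      funext t; simp [NstarV]
    rw [e, ← this]
    have := ((((hasDerivAt_inv hτ.ne').const_mul V).log (by positivity)).const_mul
      (1 / (4 * Real.pi)))
    refine this.congr_deriv ?_
    have := Real.pi_pos
    norm_num
    field_simp
  · have n2 : (0 : ℝ) < (n : ℝ) - 2 := by
      have : (2 : ℝ) < n := by exact_mod_cast (by omega : 2 < n)
      linarith
    have e : NstarV n V = fun t => cConst n * (omegaS n / (n : ℝ)) ^ (((n : ℝ) - 2) / (n : ℝ)) *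
        (t ^ (-(((n : ℝ) - 2) / (n : ℝ))) - V ^ (-(((n : ℝ) - 2) / (n : ℝ)))) := by
      funext t; simp [NstarV, h2]
    rw [e]
    have := ((Real.hasDerivAt_rpow_const (p := -(((n : ℝ) - 2) / (n : ℝ))) (Or.inl hτ.ne')).sub_const
      (V ^ (-(((n : ℝ) - 2) / (n : ℝ))))).const_mul
        (cConst n * (omegaS n / (n : ℝ)) ^ (((n : ℝ) - 2) / (n : ℝ)))
    refine this.congr_deriv ?_
    rw [c2, cConst, hω, mul_div_cancel_left₀ _ n0.ne',
      show -(((n : ℝ) - 2) / (n : ℝ)) - 1 = -(2 - 2 / (n : ℝ)) by field_simp; ring,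
      Real.rpow_neg hτ.le, show ((n : ℝ) - 2) / (n : ℝ) = 1 - 2 / (n : ℝ) by field_simp,
      Real.rpow_sub β0, Real.rpow_one]
    have : 0 < β ^ (2 / (n : ℝ)) := by positivity
    have : 0 < τ ^ (2 - 2 / (n : ℝ)) := by positivity
    field_simp
    
lemma NstarV_self {n : ℕ} {V : ℝ} (hV : 0 < V) : NstarV n V V = 0 := by
  unfold NstarV; split_ifs <;> simp [hV.ne']

lemma isoConst_pos {n : ℕ} (hn : 1 ≤ n) : 0 < isoConst n := by
  have := volume_ball_one_pos n
  unfold isoConst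
  positivity

lemma div_le_NstarV_sub {n : ℕ} (hn : 2 ≤ n) {V a b : ℝ} (hV : 0 < V) (ha : 0 < a) (hab : a < b) :
    (b - a) / (isoConst n ^ 2 * b ^ (2 - 2 / (n : ℝ))) ≤ NstarV n V a - NstarV n V b := by
  obtain ⟨c, hc, e⟩ := exists_hasDerivAt_eq_slope (NstarV n V) _ hab
    (fun x hx => (hasDerivAt_NstarV hn hV (ha.trans_le hx.1)).continuousAt.continuousWithinAt)
    fun x hx => hasDerivAt_NstarV hn hV (ha.trans hx.1)
  have c0 : 0 < c := ha.trans hc.1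
  have i0 := isoConst_pos (n := n) (by omega)
  rw [eq_div_iff (by linarith)] at e
  have n2 : (2 : ℝ) ≤ n := by exact_mod_cast hn
  have dn : 2 / (n : ℝ) ≤ 1 := (div_le_one (by linarith)).2 n2
  have : 1 / (isoConst n ^ 2 * b ^ (2 - 2 / (n : ℝ))) ≤
      1 / (isoConst n ^ 2 * c ^ (2 - 2 / (n : ℝ))) := by
    have := hc.2
    have : 0 ≤ 2 - 2 / (n : ℝ) := by linarith
    gcongr
  have h3 := mul_le_mul_of_nonneg_right this (show 0 ≤ b - a by linarith)
  rw [div_eq_mul_one_div, mul_comm]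
  linarith

lemma NstarV_nonneg {n : ℕ} (hn : 2 ≤ n) {V t : ℝ} (ht : 0 < t) (htV : t ≤ V) :
    0 ≤ NstarV n V t := by
  have hV := ht.trans_le htV
  rcases htV.eq_or_lt with rfl | h
  · rw [NstarV_self hV]
  · have := div_le_NstarV_sub hn hV ht h
    rw [NstarV_self hV] at this
    have i0 := isoConst_pos (n := n) (by omega)
    have : 0 ≤ (V - t) / (isoConst n ^ 2 * V ^ (2 - 2 / (n : ℝ))) := by
      have : 0 ≤ V - t := by linarith
      positivity
    linarith

/-- Integrating the differential inequality `κ μ(s)^p ≤ -m μ'(s)` for a possibly discontinuous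
distribution function `μ`, up to a factor `q ^ p`. -/
lemma distribution_le_of_step_aux {κ p m V q : ℝ} {μ H : ℝ → ℝ} (hκ : 0 < κ) (hp : 0 ≤ p)
    (hm : 0 ≤ m) (hq : 1 < q) (μV : ∀ s, 0 ≤ s → μ s ≤ V)
    (step : ∀ s s', 0 ≤ s → s < s' → κ * μ s' ^ p * (s' - s) ≤ m * (μ s - μ s'))
    (HV : H V = 0) (hH : ∀ a b, 0 < a → a < b → (b - a) / (κ * b ^ p) ≤ H a - H b) (k : ℕ) :
    ∀ t, 0 < t → V ≤ t * q ^ k → ∀ s, 0 ≤ s → q ^ p * m * H t < s → μ s ≤ t := by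
  induction k with
  | zero =>
    intro t _ hV s hs _
    simpa using (μV s hs).trans hV
  | succ k ih =>
    intro t ht hVt s hs hst
    rcases le_or_gt V t with hV | hV
    · exact (μV s hs).trans hV
    by_contra! hμ
    set t' := min V (t * q) with ht'
    have tt' : t < t' := lt_min hV (by nlinarith)
    have t'0 := ht.trans tt'
    have hVt' : V ≤ t' * q ^ k := by
      rcases min_choice V (t * q) with h | h
      · rw [ht', h]; exact le_mul_of_one_le_right (ht.trans hV).le (one_le_pow₀ hq.le)
      · rw [ht', h]; rw [pow_succ] at hVt; linarith
    have hHt' : 0 ≤ H t' := by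
      rcases (min_le_left V (t * q)).eq_or_lt with h | h
      · rw [ht', h, HV]
      · have := hH t' V t'0 h
        have h1 : 0 ≤ (V - t') / (κ * V ^ p) := by
          have : 0 ≤ V - t' := by linarith
          have := (t'0.trans h)
          positivity
        linarith
    have q0 : 0 < q ^ p := by positivity
    set r := q ^ p * m * H t' with hr
    have r0 : 0 ≤ r := by positivity
    have mvt := hH t t' ht tt'
    have key : q ^ p * (H t - H t') * (κ * t ^ p) ≥ t' - t := by
      have h1 : κ * t' ^ p ≤ q ^ p * (κ * t ^ p) := by
        have : t' ^ p ≤ (t * q) ^ p := Real.rpow_le_rpow t'0.le (min_le_right _ _) hp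
        rw [Real.mul_rpow ht.le (by linarith)] at this
        nlinarith
      rw [div_le_iff₀ (by positivity)] at mvt
      have h2 : 0 ≤ H t - H t' := by
        by_contra! hneg
        have : 0 < κ * t' ^ p := by positivity
        nlinarith
      nlinarith
    have rs : r < s := by
      refine lt_of_le_of_lt ?_ hst
      have h2 : H t' ≤ H t := by
        by_contra! hneg
        have : 0 < q ^ p * (κ * t ^ p) := by positivity
        nlinarith
      rw [hr]; gcongr
    have lim : ∀ s₀, r < s₀ → s₀ < s → κ * t ^ p * (s - s₀) ≤ m * (t' - t) := by
      intro s₀ h1 h2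
      have a1 := ih t' t'0 hVt' s₀ (r0.trans h1.le) h1
      have a2 := step s₀ s (r0.trans h1.le) h2
      have a3 : t ^ p ≤ μ s ^ p := Real.rpow_le_rpow ht.le hμ.le hp
      have a4 : κ * t ^ p * (s - s₀) ≤ κ * μ s ^ p * (s - s₀) := by
        have : 0 ≤ s - s₀ := by linarith
        gcongr
      have a5 : m * (μ s₀ - μ s) ≤ m * (t' - t) := by gcongr
      linarith
    have lim' : κ * t ^ p * (s - r) ≤ m * (t' - t) := by
      have : Tendsto (fun s₀ : ℝ => κ * t ^ p * (s - s₀)) (𝓝[>] r) (𝓝 (κ * t ^ p * (s - r))) :=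
        (Continuous.tendsto (by fun_prop) _).mono_left nhdsWithin_le_nhds
      refine le_of_tendsto this ?_
      filter_upwards [Ioo_mem_nhdsGT rs] with s₀ h
      exact lim s₀ h.1 h.2
    have c1 : m * (t' - t) ≤ κ * t ^ p * (q ^ p * m * (H t - H t')) := by
      have := mul_le_mul_of_nonneg_left key.le hm
      linarith
    have c2 := le_of_mul_le_mul_left (lim'.trans c1) (by positivity)
    rw [hr] at c2
    linarith

lemma distribution_le_of_step {κ p m V : ℝ} {μ H : ℝ → ℝ} (hκ : 0 < κ) (hp : 0 ≤ p)
    (hm : 0 ≤ m) (μV : ∀ s, 0 ≤ s → μ s ≤ V)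
    (step : ∀ s s', 0 ≤ s → s < s' → κ * μ s' ^ p * (s' - s) ≤ m * (μ s - μ s'))
    (HV : H V = 0) (hH : ∀ a b, 0 < a → a < b → (b - a) / (κ * b ^ p) ≤ H a - H b)
    {t s : ℝ} (ht : 0 < t) (hs : 0 ≤ s) (hst : m * H t < s) : μ s ≤ t := by
  have lim : Tendsto (fun q : ℝ => q ^ p * m * H t) (𝓝[>] 1) (𝓝 ((1 : ℝ) ^ p * m * H t)) :=
    Tendsto.mono_left ((((Real.continuousAt_rpow_const 1 p (Or.inl one_ne_zero)).mul
      continuousAt_const).mul continuousAt_const)) nhdsWithin_le_nhds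
  rw [Real.one_rpow, one_mul] at lim
  obtain ⟨q, h1, h2⟩ := ((lim.eventually_lt_const hst).and eventually_mem_nhdsWithin).exists
  obtain ⟨k, hk⟩ := pow_unbounded_of_one_lt (V / t) h2
  rw [div_lt_iff₀ ht] at hk
  exact distribution_le_of_step_aux hκ hp hm h2 μV step HV hH k t ht (by linarith) s hs h1

/-- Test functions satisfy the sharp one-sided rearrangement bound. -/
lemma IsTestFun.volume_superlevel_le {n : ℕ} (hn : 2 ≤ n) {Ω : Set (Euc n)} {φ : Euc n → ℝ}
    (h : IsTestFun n Ω φ) (hΩ : volume Ω ≠ ∞) {t s : ℝ} (ht : 0 < t) (hs : 0 ≤ s)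
    (htV : t ≤ (volume Ω).toReal)
    (hst : (1 / 2 * ∫ x in Ω, |lapl n φ x|) * NstarV n (volume Ω).toReal t < s) :
    volume {x | s < φ x} ≤ ENNReal.ofReal t := by
  rw [h.setIntegral_abs_lapl] at hst
  have hV : 0 < (volume Ω).toReal := ht.trans_le htV
  have n2 : (2 : ℝ) ≤ n := by exact_mod_cast hn
  have dn : 2 / (n : ℝ) ≤ 1 := (div_le_one (by linarith)).2 n2
  rw [ENNReal.le_ofReal_iff_toReal_le (h.volume_superlevel_ne_top hs) ht.le]
  exact distribution_le_of_step (μ := fun s => (volume {x | s < φ x}).toReal)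
    (κ := isoConst n ^ 2) (p := 2 - 2 / (n : ℝ)) (pow_pos (isoConst_pos (by omega)) 2)
    (by linarith) (mul_nonneg (by norm_num) (integral_nonneg fun x => abs_nonneg _))
    (fun s hs => ENNReal.toReal_mono hΩ (measure_mono fun x (hx : s < φ x) =>
      h.2.2 (subset_tsupport φ (hs.trans_lt hx).ne')))
    (fun s s' => h.volume_superlevel_step hn) (NstarV_self hV)
    (fun a b => div_le_NstarV_sub hn hV) ht hs hst

lemma tendsto_integral_abs_of_sub {α : Type*} [MeasurableSpace α] {μ : Measure α}
    {F : ℕ → α → ℝ} {f : α → ℝ} (hF : ∀ k, Integrable (F k) μ) (hf : Integrable f μ)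
    (h : Tendsto (fun k => ∫ x, |F k x - f x| ∂μ) atTop (𝓝 0)) :
    Tendsto (fun k => ∫ x, |F k x| ∂μ) atTop (𝓝 (∫ x, |f x| ∂μ)) := by
  rw [tendsto_iff_norm_sub_tendsto_zero]
  refine squeeze_zero (fun k => norm_nonneg _) (fun k => ?_) h
  rw [← integral_sub (hF k).abs hf.abs]
  refine (norm_integral_le_integral_norm _).trans
    (integral_mono ((hF k).abs.sub hf.abs).norm ((hF k).sub hf).abs fun x => ?_)
  exact abs_abs_sub_abs_le _ _

lemma decRearr_le_of_forall_lt {n : ℕ} {Ω : Set (Euc n)} {u : Euc n → ℝ} {t C : ℝ} (hC : 0 ≤ C)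
    (h : ∀ s, C < s → volume {x ∈ Ω | s < |u x|} ≤ ENNReal.ofReal t) : decRearr n Ω u t ≤ C :=
  le_of_forall_gt_imp_ge_of_dense fun s hs =>
    csInf_le ⟨0, fun _ hx => hx.1⟩ ⟨hC.trans hs.le, h s hs⟩

lemma decRearr_nonneg (n : ℕ) (Ω : Set (Euc n)) (u : Euc n → ℝ) (t : ℝ) : 0 ≤ decRearr n Ω u t :=
  Real.sInf_nonneg fun _ hx => hx.1

lemma decRearr_le_of_nonneg {n : ℕ} (hn : 2 ≤ n) {Ω : Set (Euc n)} (mΩ : MeasurableSet Ω)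
    (hΩ : volume Ω ≠ ∞) {u f : Euc n → ℝ} (huf : MemW21Delta0 n Ω u f)
    (u0 : ∀ᵐ x ∂(volume.restrict Ω), 0 ≤ u x) {t : ℝ} (ht : 0 < t)
    (htV : t ≤ (volume Ω).toReal) :
    decRearr n Ω u t ≤ 1 / 2 * NstarV n (volume Ω).toReal t * L1norm n Ω f := by
  obtain ⟨iu, jf, φ, hφ, lu, lf⟩ := huf
  set N := NstarV n (volume Ω).toReal t
  have N0 : 0 ≤ N := NstarV_nonneg hn ht htV
  have L0 : 0 ≤ L1norm n Ω f := integral_nonneg fun x => abs_nonneg _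
  refine decRearr_le_of_forall_lt (by positivity) fun s hs => ?_
  have conv : Tendsto (fun k => 1 / 2 * (∫ x in Ω, |lapl n (φ k) x|) * N) atTop
      (𝓝 (1 / 2 * L1norm n Ω f * N)) :=
    ((tendsto_integral_abs_of_sub (fun k => (hφ k).integrable_lapl.integrableOn) jf
      lf).const_mul _).mul_const _
  set r := (1 / 2 * N * L1norm n Ω f + s) / 2 with hr
  have r1 : 1 / 2 * N * L1norm n Ω f < r := by rw [hr]; linarith
  have r2 : r < s := by rw [hr]; linarith
  have r0 : 0 ≤ r := le_trans (by positivity) r1.le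
  have lim : Tendsto (fun k => ENNReal.ofReal t +
      ENNReal.ofReal ((∫ x in Ω, |φ k x - u x|) / (s - r))) atTop (𝓝 (ENNReal.ofReal t + 0)) := by
    refine Tendsto.add tendsto_const_nhds ?_
    rw [← ENNReal.ofReal_zero, ← zero_div (s - r)]
    exact ENNReal.tendsto_ofReal (lu.div_const _)
  rw [add_zero] at lim
  refine ge_of_tendsto lim ?_
  filter_upwards [conv.eventually_lt_const (show 1 / 2 * L1norm n Ω f * N < r by linarith)]
    with k hk
  have b1 : volume {x | r < φ k x} ≤ ENNReal.ofReal t :=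
    (hφ k).volume_superlevel_le hn hΩ ht r0 htV hk
  have i1 : Integrable (fun x => |φ k x - u x|) (volume.restrict Ω) :=
    ((hφ k).integrable.integrableOn.sub iu).abs
  have b2 : (volume.restrict Ω) {x | s - r ≤ |φ k x - u x|}
      ≤ ENNReal.ofReal ((∫ x in Ω, |φ k x - u x|) / (s - r)) := by
    have mk := mul_meas_ge_le_integral_of_nonneg (Eventually.of_forall fun x => abs_nonneg _) i1
      (s - r)
    have : IsFiniteMeasure (volume.restrict Ω) := ⟨by simpa using hΩ.lt_top⟩
    rw [← ENNReal.ofReal_toReal (measure_ne_top (volume.restrict Ω) _)]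
    refine ENNReal.ofReal_le_ofReal ?_
    rw [le_div_iff₀ (by linarith), mul_comm]
    exact mk
  calc volume {x ∈ Ω | s < |u x|} = (volume.restrict Ω) {x | s < |u x|} := by
        rw [Measure.restrict_apply' mΩ, Set.inter_comm]; rfl
    _ ≤ (volume.restrict Ω) ({x | r < φ k x} ∪ {x | s - r ≤ |φ k x - u x|}) := by
        refine measure_mono_ae ?_
        filter_upwards [u0] with x hx (hsx : s < |u x|)
        rw [abs_of_nonneg hx] at hsx
        by_contra hcon
        have h1 : ¬ (r < φ k x ∨ s - r ≤ |φ k x - u x|) := fun h => hcon h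
        push Not at h1
        have := (abs_lt.1 h1.2).1
        linarith
    _ ≤ (volume.restrict Ω) {x | r < φ k x} + (volume.restrict Ω) {x | s - r ≤ |φ k x - u x|} :=
        measure_union_le _ _
    _ ≤ _ := add_le_add ((Measure.restrict_apply_le Ω _).trans b1) b2

lemma hasDerivAt_primitive {l : ℝ → ℝ} (hl : Continuous l) (c τ : ℝ) :
    HasDerivAt (fun τ => ∫ y in c..τ, l y) (l τ) τ :=
  intervalIntegral.integral_hasDerivAt_right (hl.intervalIntegrable _ _)
    (hl.stronglyMeasurableAtFilter _ _) hl.continuousAt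

lemma contDiff_primitive {l : ℝ → ℝ} (hl : ContDiff ℝ (⊤ : ℕ∞) l) (c : ℝ) :
    ContDiff ℝ (⊤ : ℕ∞) (fun τ => ∫ y in c..τ, l y) := by
  have hd := hasDerivAt_primitive hl.continuous c
  rw [contDiff_infty_iff_deriv]
  refine ⟨fun τ => (hd τ).differentiableAt, ?_⟩
  rw [funext fun τ => (hd τ).deriv]
  exact hl

lemma lapl_comp_norm_sq {n : ℕ} {V η η' : ℝ → ℝ} (hV : ContDiff ℝ 2 V)
    (dV : ∀ τ, HasDerivAt V (η τ) τ) (dη : ∀ τ, HasDerivAt η (η' τ) τ) (x : Euc n) :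
    lapl n (fun x => V (‖x‖ ^ 2)) x = 4 * ‖x‖ ^ 2 * η' (‖x‖ ^ 2) + 2 * n * η (‖x‖ ^ 2) := by
  have dn : ∀ x : Euc n, HasFDerivAt (fun x : Euc n => ‖x‖ ^ 2) (2 • innerSL ℝ x) x := fun x =>
    (hasStrictFDerivAt_norm_sq x).hasFDerivAt
  have inn : ∀ (x : Euc n) i, inner ℝ x (EuclideanSpace.single i (1 : ℝ)) = x i := fun x i => by
    rw [EuclideanSpace.inner_single_right]; simp
  have d1 : ∀ (i : Fin n) (y : Euc n), fderiv ℝ (fun x : Euc n => V (‖x‖ ^ 2)) y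
      (EuclideanSpace.single i (1 : ℝ)) = η (‖y‖ ^ 2) * (2 * y i) := fun i y => by
    have h : HasFDerivAt (fun x : Euc n => V (‖x‖ ^ 2)) _ y := (dV _).comp_hasFDerivAt y (dn y)
    rw [h.fderiv]
    simp [inn]
  have d2 : ∀ i : Fin n, fderiv ℝ (fun y => fderiv ℝ (fun x : Euc n => V (‖x‖ ^ 2)) y
      (EuclideanSpace.single i (1 : ℝ))) x (EuclideanSpace.single i (1 : ℝ))
      = 4 * η' (‖x‖ ^ 2) * x i ^ 2 + 2 * η (‖x‖ ^ 2) := fun i => by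
    rw [funext (d1 i)]
    have c1 : HasFDerivAt (fun y : Euc n => 2 * y i)
        ((2 : ℝ) • (EuclideanSpace.proj i : Euc n →L[ℝ] ℝ)) x :=
      ((EuclideanSpace.proj i : Euc n →L[ℝ] ℝ).hasFDerivAt (x := x)).const_mul 2
    have h : HasFDerivAt (fun x : Euc n => η (‖x‖ ^ 2)) _ x := (dη _).comp_hasFDerivAt x (dn x)
    rw [(h.fun_mul c1).fderiv]
    simp [inn]
    ring
  have cV : ContDiff ℝ 2 fun x : Euc n => V (‖x‖ ^ 2) := hV.comp (contDiff_norm_sq ℝ)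
  rw [lapl_eq_sum_fderiv cV, Finset.sum_congr rfl fun i _ => d2 i,
    Finset.sum_add_distrib, ← Finset.mul_sum]
  have : ∑ i, x i ^ 2 = ‖x‖ ^ 2 := by
    rw [EuclideanSpace.norm_sq_eq]; simp
  rw [this]
  simp
  ring

/-- The profile, as a function of `‖x‖ ^ 2`, of the radial function vanishing on `‖x‖ ^ 2 = c`
whose flux through the sphere `‖x‖ ^ 2 = τ` is proportional to `L τ`. -/
def radialProfile (n : ℕ) (L : ℝ → ℝ) (c τ : ℝ) : ℝ := ∫ s in c..τ, L s * s ^ (-((n : ℝ) / 2))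

section radialProfile

variable {n : ℕ} {L : ℝ → ℝ} {a : ℝ}

lemma contDiff_mul_rpow_of_eq_zero (hL : ContDiff ℝ (⊤ : ℕ∞) L) (ha : 0 < a)
    (L0 : ∀ τ ≤ a, L τ = 0) (p : ℝ) : ContDiff ℝ (⊤ : ℕ∞) fun s => L s * s ^ p := by
  rw [contDiff_iff_contDiffAt]
  intro τ
  rcases lt_or_ge τ a with h | h
  · refine (contDiffAt_const (c := (0 : ℝ))).congr_of_eventuallyEq ?_
    filter_upwards [Iio_mem_nhds h] with s hs
    rw [L0 s (le_of_lt hs), zero_mul]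
  · exact hL.contDiffAt.mul (Real.contDiffAt_rpow_const_of_ne (ha.trans_le h).ne')

lemma contDiff_radialProfile (hL : ContDiff ℝ (⊤ : ℕ∞) L) (ha : 0 < a) (L0 : ∀ τ ≤ a, L τ = 0)
    (c : ℝ) : ContDiff ℝ (⊤ : ℕ∞) (radialProfile n L c) :=
  contDiff_primitive (contDiff_mul_rpow_of_eq_zero hL ha L0 _) c

lemma contDiff_radialProfile_norm_sq (hL : ContDiff ℝ (⊤ : ℕ∞) L) (ha : 0 < a)
    (L0 : ∀ τ ≤ a, L τ = 0) (c : ℝ) :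
    ContDiff ℝ (⊤ : ℕ∞) fun x : Euc n => radialProfile n L c (‖x‖ ^ 2) :=
  (contDiff_radialProfile hL ha L0 c).comp (contDiff_norm_sq ℝ)

lemma lapl_radialProfile {l : ℝ → ℝ} (hL : ContDiff ℝ (⊤ : ℕ∞) L) (ha : 0 < a)
    (L0 : ∀ τ ≤ a, L τ = 0) (dL : ∀ τ, HasDerivAt L (l τ) τ) (c : ℝ) (x : Euc n) :
    lapl n (fun x => radialProfile n L c (‖x‖ ^ 2)) x =
      (‖x‖ ^ 2) ^ (1 - (n : ℝ) / 2) * (4 * l (‖x‖ ^ 2)) := by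
  have hη := contDiff_mul_rpow_of_eq_zero hL ha L0 (-((n : ℝ) / 2))
  have dη : ∀ τ, HasDerivAt (fun s => L s * s ^ (-((n : ℝ) / 2)))
      (deriv (fun s => L s * s ^ (-((n : ℝ) / 2))) τ) τ := fun τ =>
    ((contDiff_infty.1 hη 1).differentiable one_ne_zero τ).hasDerivAt
  rw [lapl_comp_norm_sq (contDiff_infty.1 (contDiff_radialProfile hL ha L0 c) 2)
    (fun τ => hasDerivAt_primitive hη.continuous c τ) dη x]
  set τ := ‖x‖ ^ 2
  rcases lt_or_ge τ a with h | h
  · have e1 : L =ᶠ[𝓝 τ] fun _ => 0 := by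
      filter_upwards [Iio_mem_nhds h] with s hs
      exact L0 s (le_of_lt hs)
    have e2 : (fun s => L s * s ^ (-((n : ℝ) / 2))) =ᶠ[𝓝 τ] fun _ => 0 := by
      filter_upwards [e1] with s hs
      rw [hs, zero_mul]
    have l0 : l τ = 0 := by rw [← (dL τ).deriv, e1.deriv_eq]; simp
    rw [e2.deriv_eq, l0, L0 τ h.le]
    simp
  · have τ0 : 0 < τ := ha.trans_le h
    rw [((dL τ).fun_mul (Real.hasDerivAt_rpow_const (Or.inl τ0.ne'))).deriv, Real.rpow_sub_one τ0.ne',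
      sub_eq_add_neg, Real.rpow_add τ0, Real.rpow_one]
    field_simp
    ring

end radialProfile

section polar

variable {n : ℕ} {G : ℝ → ℝ}

lemma pow_smul_comp_sq_eq (hn : 2 ≤ n) (y : ℝ) (hy : y ∈ Set.Ioi (0 : ℝ)) :
    y ^ (n - 1) • ((y ^ 2) ^ (1 - (n : ℝ) / 2) * G (y ^ 2)) =
      (1 / 2 : ℝ) * ((|2| * y ^ ((2 : ℝ) - 1)) • G (y ^ (2 : ℝ))) := by
  have hy : 0 < y := hy
  have e1 : y ^ (n - 1) = y ^ ((n : ℝ) - 1) := by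
    rw [← Real.rpow_natCast, Nat.cast_sub (by omega), Nat.cast_one]
  have e2 : (y ^ 2) ^ (1 - (n : ℝ) / 2) = y ^ (2 - (n : ℝ)) := by
    rw [← Real.rpow_natCast, ← Real.rpow_mul hy.le]; congr 1; push_cast; ring
  have e3 : y ^ ((n : ℝ) - 1) * y ^ (2 - (n : ℝ)) = y := by
    rw [← Real.rpow_add hy]; norm_num
  rw [e1, e2, smul_eq_mul, ← mul_assoc, e3, Real.rpow_two, show (2 : ℝ) - 1 = 1 by norm_num,
    Real.rpow_one, abs_of_pos two_pos, smul_eq_mul]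
  ring

lemma integrable_rpow_mul_comp_norm_sq (hn : 2 ≤ n) :
    Integrable (fun x : Euc n => (‖x‖ ^ 2) ^ (1 - (n : ℝ) / 2) * G (‖x‖ ^ 2)) ↔
      IntegrableOn G (Set.Ioi 0) := by
  have : Nonempty (Fin n) := ⟨⟨0, by omega⟩⟩
  rw [integrable_fun_norm_addHaar (volume : Measure (Euc n))
    (f := fun r => (r ^ 2) ^ (1 - (n : ℝ) / 2) * G (r ^ 2)), finrank_euclideanSpace_fin,
    ← integrableOn_Ioi_comp_rpow_iff G two_ne_zero,
    integrableOn_congr_fun (pow_smul_comp_sq_eq hn) measurableSet_Ioi]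
  exact integrable_const_mul_iff (isUnit_iff_ne_zero.2 (by norm_num)) _

lemma integral_rpow_mul_comp_norm_sq (hn : 2 ≤ n) :
    ∫ x : Euc n, (‖x‖ ^ 2) ^ (1 - (n : ℝ) / 2) * G (‖x‖ ^ 2) =
      omegaS n / 2 * ∫ τ in Set.Ioi 0, G τ := by
  have : Nonempty (Fin n) := ⟨⟨0, by omega⟩⟩
  rw [integral_fun_norm_addHaar (volume : Measure (Euc n))
    (fun r => (r ^ 2) ^ (1 - (n : ℝ) / 2) * G (r ^ 2)), finrank_euclideanSpace_fin,
    setIntegral_congr_fun measurableSet_Ioi (pow_smul_comp_sq_eq hn), integral_const_mul,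
    abs_of_pos two_pos, integral_comp_rpow_Ioi_of_pos two_pos, omegaS_eq_mul_volume_ball hn]
  simp [Measure.real]
  ring

end polar

lemma omegaS_pos {n : ℕ} (hn : 2 ≤ n) : 0 < omegaS n := by
  rw [omegaS_eq_mul_volume_ball hn]
  have := volume_ball_one_pos n
  have : (0 : ℝ) < n := by exact_mod_cast (by omega : 0 < n)
  positivity

lemma toReal_volume_ball {n : ℕ} (hn : 2 ≤ n) {r : ℝ} (hr : 0 ≤ r) :
    (volume (Metric.ball (0 : Euc n) r)).toReal =
      (volume (Metric.ball (0 : Euc n) 1)).toReal * r ^ n := by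
  have : Nonempty (Fin n) := ⟨⟨0, by omega⟩⟩
  rw [Measure.addHaar_ball _ _ hr, finrank_euclideanSpace_fin, ENNReal.toReal_mul,
    ENNReal.toReal_ofReal (by positivity), mul_comm]

lemma NstarV_eq_integral {n : ℕ} (hn : 2 ≤ n) {β r R : ℝ}
    (hβ : β = (volume (Metric.ball (0 : Euc n) 1)).toReal) (hr : 0 < r) (hR : 0 < R) :
    NstarV n (β * R ^ n) (β * r ^ n) =
      1 / (2 * omegaS n) * ∫ s in (r ^ 2)..(R ^ 2), s ^ (-((n : ℝ) / 2)) := by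
  have β0 : 0 < β := hβ ▸ volume_ball_one_pos n
  have n0 : (0 : ℝ) < n := by exact_mod_cast (by omega : 0 < n)
  have hω : omegaS n = n * β := hβ ▸ omegaS_eq_mul_volume_ball hn
  have hz : (0 : ℝ) ∉ Set.uIcc (r ^ 2) (R ^ 2) := fun h => by
    have := (Set.mem_uIcc.1 h)
    have : 0 < r ^ 2 := by positivity
    have : 0 < R ^ 2 := by positivity
    grind
  by_cases h2 : n = 2
  · subst h2
    have e : ∀ s : ℝ, s ^ (-(((2 : ℕ) : ℝ) / 2)) = s⁻¹ := fun s => by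
      rw [← Real.rpow_neg_one]; norm_num
    simp_rw [e]
    rw [integral_inv hz, NstarV, if_pos rfl, mul_div_mul_left _ _ β0.ne', omegaS]
    norm_num
    left
    ring
  · have n2 : (0 : ℝ) < (n : ℝ) - 2 := by
      have : (2 : ℝ) < n := by exact_mod_cast (by omega : 2 < n)
      linarith
    have key : ∀ x : ℝ, 0 < x → (β * x ^ n) ^ (-(((n : ℝ) - 2) / (n : ℝ))) =
        β ^ (-(((n : ℝ) - 2) / (n : ℝ))) * (x ^ 2) ^ (-((n : ℝ) / 2) + 1) := fun x hx => by
      rw [Real.mul_rpow β0.le (by positivity), ← Real.rpow_natCast x n, ← Real.rpow_mul hx.le,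
        ← Real.rpow_natCast x 2, ← Real.rpow_mul hx.le]
      congr 2
      field_simp
      push_cast
      ring
    rw [integral_rpow (Or.inr ⟨by intro h; linarith, hz⟩), NstarV, if_neg h2, key r hr, key R hR,
      cConst, hω, mul_div_cancel_left₀ _ n0.ne', Real.rpow_neg β0.le]
    have : 0 < β ^ (((n : ℝ) - 2) / (n : ℝ)) := by positivity
    have : -((n : ℝ) / 2) + 1 ≠ 0 := by intro h; linarith
    have : -(n : ℝ) + 2 ≠ 0 := by intro h; linarith
    field_simp
    ring

lemma bump_primitive_bounds {l : ℝ → ℝ} {p q : ℝ} (hl : Continuous l) (l0 : ∀ x, 0 ≤ l x)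
    (lz : ∀ x, x ∉ Set.Ioo p q → l x = 0) (hpq : p ≤ q) (l1 : ∫ x, l x = 1) :
    (∀ τ ≤ p, ∫ y in p..τ, l y = 0) ∧ (∀ τ ≥ q, ∫ y in p..τ, l y = 1) ∧
      (∀ τ, 0 ≤ ∫ y in p..τ, l y) ∧ ∀ τ, ∫ y in p..τ, l y ≤ 1 := by
  have hm : Monotone (fun τ => ∫ y in p..τ, l y) :=
    monotone_of_deriv_nonneg (fun x => (hasDerivAt_primitive hl p x).differentiableAt) fun x => by
      rw [(hasDerivAt_primitive hl p x).deriv]; exact l0 x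
  have h0 : ∀ τ ≤ p, ∫ y in p..τ, l y = 0 := fun τ hτ => by
    rw [intervalIntegral.integral_congr (g := fun _ => (0 : ℝ))]
    · simp
    · intro y hy
      rw [Set.uIcc_of_ge hτ] at hy
      exact lz y fun h => absurd h.1 (not_lt.2 hy.2)
  have h1 : ∀ τ ≥ q, ∫ y in p..τ, l y = 1 := fun τ hτ => by
    rw [intervalIntegral.integral_of_le (hpq.trans hτ),
      setIntegral_eq_integral_of_forall_compl_eq_zero, l1]
    exact fun x hx => lz x fun h => hx ⟨h.1, h.2.le.trans hτ⟩
  refine ⟨h0, h1, fun τ => ?_, fun τ => ?_⟩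
  · rcases le_total τ p with h | h
    · exact (h0 τ h).ge
    · exact (h0 p le_rfl).ge.trans (hm h)
  · rcases le_total τ q with h | h
    · exact (hm h).trans (h1 q le_rfl).le
    · exact (h1 τ h).le

lemma exists_smooth_unit_bump {p q : ℝ} (hpq : p < q) : ∃ l : ℝ → ℝ, ContDiff ℝ (⊤ : ℕ∞) l ∧
    (∀ x, 0 ≤ l x) ∧ (∀ x, x ∉ Set.Ioo p q → l x = 0) ∧ Integrable l ∧ ∫ x, l x = 1 := by
  let φ : ContDiffBump ((p + q) / 2 : ℝ) := ⟨(q - p) / 4, (q - p) / 2, by linarith, by linarith⟩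
  refine ⟨φ.normed volume, φ.contDiff_normed, φ.nonneg_normed, fun x hx => ?_,
    φ.integrable_normed, φ.integral_normed⟩
  have : x ∉ Function.support (φ.normed volume) := by
    rw [φ.support_normed_eq, Real.ball_eq_Ioo]
    simp only [φ]
    intro h
    exact hx ⟨by linarith [h.1], by linarith [h.2]⟩
  simpa using this

/-- A radial test function realizing (almost) the extremal ratio. -/
lemma exists_radial_testFun {n : ℕ} (hn : 2 ≤ n) {R a b : ℝ} (hR : 0 < R) (ha : 0 < a)
    (hab : a < b) (hb : b < R ^ 2) : ∃ U : ℝ → ℝ,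
      IsTestFun n (Metric.ball 0 R) (fun x => U (‖x‖ ^ 2)) ∧
      (∀ x : Euc n, 0 ≤ U (‖x‖ ^ 2)) ∧
      (∀ x : Euc n, ‖x‖ ^ 2 ≤ a → ∫ s in a..b, s ^ (-((n : ℝ) / 2)) ≤ U (‖x‖ ^ 2)) ∧
      ∫ x, |lapl n (fun x => U (‖x‖ ^ 2)) x| ≤ 4 * omegaS n := by
  set b' := (b + R ^ 2) / 2 with hb'
  have bb' : b < b' := by rw [hb']; linarith
  have b'R : b' < R ^ 2 := by rw [hb']; linarith
  obtain ⟨l₁, s₁, p₁, z₁, i₁, e₁⟩ := exists_smooth_unit_bump (show a / 2 < a by linarith)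
  obtain ⟨l₂, s₂, p₂, z₂, i₂, e₂⟩ := exists_smooth_unit_bump bb'
  obtain ⟨A0, A1, Ap, Al⟩ := bump_primitive_bounds s₁.continuous p₁ z₁ (by linarith) e₁
  obtain ⟨B0, B1, Bp, Bl⟩ := bump_primitive_bounds s₂.continuous p₂ z₂ bb'.le e₂
  set A : ℝ → ℝ := fun τ => ∫ y in (a / 2)..τ, l₁ y with hA
  set B : ℝ → ℝ := fun τ => ∫ y in b..τ, l₂ y with hB
  set L : ℝ → ℝ := fun τ => B τ - A τ with hL
  have Ls : ContDiff ℝ (⊤ : ℕ∞) L := (contDiff_primitive s₂ b).sub (contDiff_primitive s₁ (a / 2))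
  have L0 : ∀ τ ≤ a / 2, L τ = 0 := fun τ hτ => by
    simp only [hL, hA, hB, A0 τ hτ, B0 τ (by linarith), sub_zero]
  have Lneg : ∀ τ, L τ ≤ 0 := fun τ => by
    rcases le_total τ b with h | h
    · have h1 := B0 τ h; have h2 := Ap τ
      simp only [hL, hA, hB]; linarith
    · have h1 := A1 τ (by linarith); have h2 := Bl τ
      simp only [hL, hA, hB]; linarith
  have Lmid : ∀ τ ∈ Set.Icc a b, L τ = -1 := fun τ hτ => by
    simp only [hL, hA, hB, A1 τ hτ.1, B0 τ hτ.2, zero_sub]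
  have Lend : ∀ τ ≥ b', L τ = 0 := fun τ hτ => by
    simp only [hL, hA, hB, A1 τ (by linarith), B1 τ hτ, sub_self]
  have dL : ∀ τ, HasDerivAt L (l₂ τ - l₁ τ) τ := fun τ =>
    (hasDerivAt_primitive s₂.continuous b τ).sub (hasDerivAt_primitive s₁.continuous (a / 2) τ)
  have a2 : 0 < a / 2 := by linarith
  have ηc : Continuous fun s => L s * s ^ (-((n : ℝ) / 2)) :=
    (contDiff_mul_rpow_of_eq_zero Ls a2 L0 _).continuous
  have Uz : ∀ τ ≥ b', radialProfile n L (R ^ 2) τ = 0 := fun τ hτ => by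
    rw [radialProfile, intervalIntegral.integral_congr (g := fun _ => (0 : ℝ))]
    · simp
    · intro y hy
      have : b' ≤ y := (le_min b'R.le hτ).trans hy.1
      simp [Lend y this]
  have Ueq : ∀ τ, radialProfile n L (R ^ 2) τ =
      ∫ s in τ..(R ^ 2), -(L s * s ^ (-((n : ℝ) / 2))) := fun τ => by
    rw [radialProfile, intervalIntegral.integral_symm, intervalIntegral.integral_neg]
  have ηpos : ∀ s, 0 ≤ s → 0 ≤ -(L s * s ^ (-((n : ℝ) / 2))) := fun s hs => by
    have h1 := Lneg s
    have h2 : 0 ≤ s ^ (-((n : ℝ) / 2)) := by positivity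
    nlinarith
  refine ⟨radialProfile n L (R ^ 2), ⟨contDiff_radialProfile_norm_sq Ls a2 L0 _, ?_⟩, ?_, ?_, ?_⟩
  · have ssub : Function.support (fun x : Euc n => radialProfile n L (R ^ 2) (‖x‖ ^ 2)) ⊆
        Metric.closedBall 0 (Real.sqrt b') := fun x hx => by
      rw [mem_closedBall_zero_iff]
      refine Real.le_sqrt_of_sq_le ?_
      by_contra! h
      exact hx (Uz _ h.le)
    refine ⟨HasCompactSupport.of_support_subset_isCompact (isCompact_closedBall _ _) ssub,
      (closure_minimal ssub Metric.isClosed_closedBall).trans (Metric.closedBall_subset_ball ?_)⟩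
    rw [Real.sqrt_lt' hR]
    exact b'R
  · intro x
    rcases le_total (‖x‖ ^ 2) (R ^ 2) with h | h
    · rw [Ueq]
      exact intervalIntegral.integral_nonneg h fun s hs => ηpos s ((sq_nonneg _).trans hs.1)
    · exact (Uz _ (b'R.le.trans h)).ge
  · intro x hx
    rw [Ueq]
    have e : ∫ s in a..b, s ^ (-((n : ℝ) / 2)) =
        ∫ s in a..b, -(L s * s ^ (-((n : ℝ) / 2))) := by
      refine intervalIntegral.integral_congr fun s hs => ?_
      rw [Set.uIcc_of_le hab.le] at hs
      simp [Lmid s hs]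
    rw [e]
    refine intervalIntegral.integral_mono_interval hx hab.le hb.le ?_
      (ηc.neg.intervalIntegrable _ _)
    refine (ae_restrict_iff' measurableSet_Ioc).2 (Eventually.of_forall fun s hs => ?_)
    exact ηpos s ((sq_nonneg _).trans hs.1.le)
  · simp_rw [lapl_radialProfile Ls a2 L0 dL]
    have e : ∀ x : Euc n, |(‖x‖ ^ 2) ^ (1 - (n : ℝ) / 2) * (4 * (l₂ (‖x‖ ^ 2) - l₁ (‖x‖ ^ 2)))| =
        (‖x‖ ^ 2) ^ (1 - (n : ℝ) / 2) *
          (fun τ => 4 * |l₂ τ - l₁ τ|) (‖x‖ ^ 2) := fun x => by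
      rw [abs_mul, abs_mul, abs_of_nonneg (by positivity : (0 : ℝ) ≤ (‖x‖ ^ 2) ^ (1 - (n : ℝ) / 2)),
        abs_of_pos (by norm_num : (0 : ℝ) < 4)]
    simp_rw [e]
    rw [integral_rpow_mul_comp_norm_sq hn (G := fun τ => 4 * |l₂ τ - l₁ τ|), integral_const_mul]
    have ω0 := omegaS_pos hn
    have : ∫ τ in Set.Ioi 0, |l₂ τ - l₁ τ| ≤ 2 := calc
      _ ≤ ∫ τ, |l₂ τ - l₁ τ| :=
        setIntegral_le_integral (i₂.sub i₁).abs (Eventually.of_forall fun x => abs_nonneg _)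
      _ ≤ ∫ τ, (l₂ τ + l₁ τ) := integral_mono (i₂.sub i₁).abs (i₂.add i₁) fun x => by
        have h1 := p₁ x; have h2 := p₂ x
        change |l₂ x - l₁ x| ≤ l₂ x + l₁ x
        rw [abs_le]
        constructor <;> linarith
      _ = 2 := by rw [integral_add i₂ i₁, e₁, e₂]; norm_num
    nlinarith

lemma abs_setIntegral_mul_lapl_le {n : ℕ} {Ω : Set (Euc n)} (mΩ : MeasurableSet Ω)
    (bΩ : Bornology.IsBounded Ω) {u f v : Euc n → ℝ} (huf : MemW21Delta0 n Ω u f)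
    (hv : ContDiff ℝ 2 v) {c K : ℝ} (hK : ∀ x ∈ Ω, |v x - c| ≤ K) :
    |∫ x in Ω, u x * lapl n v x| ≤ K * L1norm n Ω f := by
  obtain ⟨iu, jf, φ, hφ, lu, lf⟩ := huf
  have lc := continuous_lapl hv
  obtain ⟨C, hC⟩ := (bΩ.isCompact_closure.exists_bound_of_continuousOn lc.continuousOn)
  have bd : ∀ᵐ x ∂(volume.restrict Ω), ‖lapl n v x‖ ≤ C :=
    (ae_restrict_iff' mΩ).2 (Eventually.of_forall fun x hx => hC x (subset_closure hx))
  have int : ∀ {w : Euc n → ℝ}, IntegrableOn w Ω → IntegrableOn (fun x => w x * lapl n v x) Ω :=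
    fun {w} hw => hw.mul_bdd lc.aestronglyMeasurable bd
  have iφ : ∀ k, IntegrableOn (φ k) Ω := fun k => (hφ k).integrable.integrableOn
  have lim1 : Tendsto (fun k => ∫ x in Ω, φ k x * lapl n v x) atTop
      (𝓝 (∫ x in Ω, u x * lapl n v x)) := by
    rw [tendsto_iff_norm_sub_tendsto_zero]
    have := lu.mul_const C
    rw [zero_mul] at this
    refine squeeze_zero (fun k => norm_nonneg _) (fun k => ?_) this
    rw [← integral_sub (int (iφ k)) (int iu), ← integral_mul_const]
    refine (norm_integral_le_integral_norm _).trans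
      (integral_mono_ae ((int (iφ k)).sub (int iu)).norm
        (((iφ k).sub iu).abs.mul_const C) ?_)
    filter_upwards [bd] with x hx
    change ‖φ k x * lapl n v x - u x * lapl n v x‖ ≤ |φ k x - u x| * C
    rw [← sub_mul, norm_mul]
    exact mul_le_mul_of_nonneg_left hx (abs_nonneg _)
  have lim2 : Tendsto (fun k => K * ∫ x in Ω, |lapl n (φ k) x|) atTop (𝓝 (K * L1norm n Ω f)) :=
    (tendsto_integral_abs_of_sub (fun k => (hφ k).integrable_lapl.integrableOn) jf lf).const_mul K
  refine le_of_tendsto_of_tendsto' lim1.abs lim2 fun k => ?_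
  have z : ∀ x, x ∉ Ω → φ k x = 0 := fun x hx =>
    image_eq_zero_of_notMem_tsupport fun h => hx ((hφ k).2.2 h)
  have zl : ∀ x, x ∉ Ω → lapl n (φ k) x = 0 := fun x hx =>
    lapl_eq_zero_of_notMem_tsupport fun h => hx ((hφ k).2.2 h)
  have iv : Integrable fun x => v x * lapl n (φ k) x :=
    (hv.continuous.mul (continuous_lapl (hφ k).contDiff_two)).integrable_of_hasCompactSupport
      (hφ k).hasCompactSupport_lapl.mul_left
  have e : ∫ x in Ω, φ k x * lapl n v x = ∫ x in Ω, (v x - c) * lapl n (φ k) x := by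
    rw [setIntegral_eq_integral_of_forall_compl_eq_zero fun x hx => by rw [z x hx, zero_mul],
      setIntegral_eq_integral_of_forall_compl_eq_zero fun x hx => by rw [zl x hx, mul_zero],
      ← integral_mul_lapl_comm hv (hφ k).contDiff_two (hφ k).2.1]
    simp_rw [sub_mul]
    rw [integral_sub iv ((hφ k).integrable_lapl.const_mul c), integral_const_mul,
      (hφ k).integral_lapl, mul_zero, sub_zero]
  rw [e, ← integral_const_mul, ← Real.norm_eq_abs]
  refine norm_integral_le_of_norm_le ((hφ k).integrable_lapl.abs.integrableOn.const_mul K) ?_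
  refine (ae_restrict_iff' mΩ).2 (Eventually.of_forall fun x hx => ?_)
  rw [norm_mul]
  exact mul_le_mul_of_nonneg_right (hK x hx) (abs_nonneg _)

section radial

variable {n : ℕ} {R a : ℝ} {u f : Euc n → ℝ} {g : ℝ → ℝ}

lemma integrable_indicator_radial (hn : 2 ≤ n) (ha : 0 < a) (hR : 0 < R)
    (iu : IntegrableOn u (Metric.ball 0 R)) (hug : ∀ x, u x = g ‖x‖) :
    Integrable ((Set.Ioo a (R ^ 2)).indicator fun τ => g (Real.sqrt τ)) := by
  set P := (Set.Ioo a (R ^ 2)).indicator fun τ => g (Real.sqrt τ) with hP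
  have P0 : ∀ τ, τ ∉ Set.Ioi (0 : ℝ) → P τ = 0 := fun τ hτ =>
    Set.indicator_of_notMem (fun h => hτ (ha.trans h.1)) _
  rw [← integrableOn_iff_integrable_of_support_subset (s := Set.Ioi 0) (fun τ hτ => by
    by_contra h; exact hτ (P0 τ h)), ← integrable_rpow_mul_comp_norm_sq hn]
  have iB : Integrable ((Metric.ball (0 : Euc n) R).indicator u) :=
    (integrable_indicator_iff measurableSet_ball).2 iu
  have mA : MeasurableSet {x : Euc n | a < ‖x‖ ^ 2} :=
    measurableSet_lt measurable_const (by fun_prop)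
  have n2 : (2 : ℝ) ≤ n := by exact_mod_cast hn
  have mw : Measurable ({x : Euc n | a < ‖x‖ ^ 2}.indicator
      fun x : Euc n => (‖x‖ ^ 2) ^ (1 - (n : ℝ) / 2)) :=
    Measurable.indicator (Measurable.pow_const (by fun_prop) _) mA
  refine (iB.bdd_mul (c := a ^ (1 - (n : ℝ) / 2)) mw.aestronglyMeasurable
    (Eventually.of_forall fun x => ?_)).congr (Eventually.of_forall fun x => ?_)
  · by_cases hx : x ∈ {x : Euc n | a < ‖x‖ ^ 2}
    · rw [Set.indicator_of_mem hx, Real.norm_of_nonneg (by positivity)]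
      exact Real.rpow_le_rpow_of_nonpos ha (le_of_lt hx) (by linarith)
    · rw [Set.indicator_of_notMem hx, norm_zero]
      positivity
  · simp only
    by_cases hx : x ∈ {x : Euc n | a < ‖x‖ ^ 2}
    · rw [Set.indicator_of_mem hx]
      congr 1
      by_cases hB : x ∈ Metric.ball (0 : Euc n) R
      · rw [Set.indicator_of_mem hB, hP, Set.indicator_of_mem, Real.sqrt_sq (norm_nonneg _), hug]
        rw [mem_ball_zero_iff] at hB
        exact ⟨hx, by gcongr⟩
      · rw [Set.indicator_of_notMem hB, hP, Set.indicator_of_notMem]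
        rw [mem_ball_zero_iff, not_lt] at hB
        exact fun h => absurd h.2 (not_lt.2 (by gcongr))
    · rw [Set.indicator_of_notMem hx, zero_mul, hP, Set.indicator_of_notMem (fun h => hx h.1),
        mul_zero]

/-- Averages of a radial function against radial bumps, by duality with radial potentials. -/
lemma abs_integral_radial_mul_bump_le (hn : 2 ≤ n) (ha : 0 < a) (haR : a ≤ R ^ 2) (hR : 0 < R)
    (huf : MemW21Delta0 n (Metric.ball 0 R) u f) (hug : ∀ x, u x = g ‖x‖)
    {l : ℝ → ℝ} {p q : ℝ} (hap : a ≤ p) (hpq : p ≤ q) (ls : ContDiff ℝ (⊤ : ℕ∞) l)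
    (l0 : ∀ x, 0 ≤ l x) (lz : ∀ x, x ∉ Set.Ioo p q → l x = 0) (l1 : ∫ x, l x = 1) :
    |∫ τ, (Set.Ioo a (R ^ 2)).indicator (fun τ => g (Real.sqrt τ)) τ * l τ| ≤
      1 / 2 * (1 / (2 * omegaS n) * ∫ s in a..(R ^ 2), s ^ (-((n : ℝ) / 2))) *
        L1norm n (Metric.ball 0 R) f := by
  set P := (Set.Ioo a (R ^ 2)).indicator fun τ => g (Real.sqrt τ) with hP
  set M := ∫ s in a..(R ^ 2), s ^ (-((n : ℝ) / 2)) with hM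
  obtain ⟨A0, -, Ap, Al⟩ := bump_primitive_bounds ls.continuous l0 lz hpq l1
  set A : ℝ → ℝ := fun τ => ∫ y in p..τ, l y with hA
  have p0 : 0 < p := ha.trans_le hap
  have As : ContDiff ℝ (⊤ : ℕ∞) A := contDiff_primitive ls p
  have dA : ∀ τ, HasDerivAt A (l τ) τ := hasDerivAt_primitive ls.continuous p
  have ηc : Continuous fun s => A s * s ^ (-((n : ℝ) / 2)) :=
    (contDiff_mul_rpow_of_eq_zero As p0 A0 _).continuous
  have ηpos : ∀ s, 0 ≤ s → 0 ≤ A s * s ^ (-((n : ℝ) / 2)) := fun s hs =>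
    mul_nonneg (Ap s) (by positivity)
  have bound : ∀ x ∈ Metric.ball (0 : Euc n) R,
      |radialProfile n A (R ^ 2) (‖x‖ ^ 2) - -(M / 2)| ≤ M / 2 := by
    intro x hx
    rw [mem_ball_zero_iff] at hx
    have hx2 : ‖x‖ ^ 2 ≤ R ^ 2 := by gcongr
    have e1 : radialProfile n A (R ^ 2) (‖x‖ ^ 2) =
        -∫ s in (‖x‖ ^ 2)..(R ^ 2), A s * s ^ (-((n : ℝ) / 2)) :=
      intervalIntegral.integral_symm _ _
    have e2 : 0 ≤ ∫ s in (‖x‖ ^ 2)..(R ^ 2), A s * s ^ (-((n : ℝ) / 2)) :=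
      intervalIntegral.integral_nonneg hx2 fun s hs => ηpos s ((sq_nonneg _).trans hs.1)
    have e3 : ∫ s in (‖x‖ ^ 2)..(R ^ 2), A s * s ^ (-((n : ℝ) / 2)) ≤
        ∫ s in (0 : ℝ)..(R ^ 2), A s * s ^ (-((n : ℝ) / 2)) :=
      intervalIntegral.integral_mono_interval (sq_nonneg _) hx2 le_rfl
        ((ae_restrict_iff' measurableSet_Ioc).2 (Eventually.of_forall fun s hs => ηpos s hs.1.le))
        (ηc.intervalIntegrable _ _)
    have e4 : ∫ s in (0 : ℝ)..a, A s * s ^ (-((n : ℝ) / 2)) = 0 := by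
      rw [intervalIntegral.integral_congr (g := fun _ => (0 : ℝ))]
      · simp
      · intro y hy
        rw [Set.uIcc_of_le ha.le] at hy
        have : A y = 0 := A0 y (hy.2.trans hap)
        simp [this]
    have e5 : ∫ s in a..(R ^ 2), A s * s ^ (-((n : ℝ) / 2)) ≤ M := by
      refine intervalIntegral.integral_mono_on haR (ηc.intervalIntegrable _ _)
        (intervalIntegral.intervalIntegrable_rpow (Or.inr fun h => ?_)) fun s hs => ?_
      · rw [Set.uIcc_of_le haR] at h
        exact absurd h.1 (not_le.2 ha)
      · have : 0 ≤ s ^ (-((n : ℝ) / 2)) := Real.rpow_nonneg (ha.le.trans hs.1) _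
        exact mul_le_of_le_one_left this (Al s)
    have e6 := intervalIntegral.integral_add_adjacent_intervals
      (ηc.intervalIntegrable (μ := volume) 0 a) (ηc.intervalIntegrable a (R ^ 2))
    rw [e1, abs_le]
    constructor <;> linarith
  have key := abs_setIntegral_mul_lapl_le measurableSet_ball Metric.isBounded_ball huf
    (contDiff_infty.1 (contDiff_radialProfile_norm_sq As p0 A0 (R ^ 2)) 2) bound
  have e : ∫ x in Metric.ball (0 : Euc n) R,
      u x * lapl n (fun x => radialProfile n A (R ^ 2) (‖x‖ ^ 2)) x =
      2 * omegaS n * ∫ τ, P τ * l τ := by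
    have hz : ∀ τ, τ ∉ Set.Ioi (0 : ℝ) → P τ * l τ = 0 := fun τ hτ => by
      rw [hP, Set.indicator_of_notMem (fun h => hτ (ha.trans h.1)), zero_mul]
    rw [← setIntegral_eq_integral_of_forall_compl_eq_zero hz,
      show 2 * omegaS n * ∫ τ in Set.Ioi 0, P τ * l τ =
        omegaS n / 2 * (4 * ∫ τ in Set.Ioi 0, P τ * l τ) by ring, ← integral_const_mul,
      ← integral_rpow_mul_comp_norm_sq hn (G := fun τ => 4 * (P τ * l τ)),
      ← integral_indicator measurableSet_ball]
    refine integral_congr_ae (Eventually.of_forall fun x => ?_)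
    simp only
    by_cases hB : x ∈ Metric.ball (0 : Euc n) R
    · rw [Set.indicator_of_mem hB, lapl_radialProfile As p0 A0 dA]
      rcases le_or_gt (‖x‖ ^ 2) a with h | h
      · rw [lz _ fun k => absurd k.1 (not_lt.2 (h.trans hap))]
        ring
      · have : P (‖x‖ ^ 2) = u x := by
          rw [mem_ball_zero_iff] at hB
          rw [hP, Set.indicator_of_mem (show ‖x‖ ^ 2 ∈ Set.Ioo a (R ^ 2) from ⟨h, by gcongr⟩), Real.sqrt_sq (norm_nonneg _), hug]
        rw [this]
        ring
    · rw [Set.indicator_of_notMem hB, hP, Set.indicator_of_notMem]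
      · ring
      · rw [mem_ball_zero_iff, not_lt] at hB
        exact fun h => absurd h.2 (not_lt.2 (by gcongr))
  have ω0 := omegaS_pos hn
  rw [e, abs_mul, abs_of_pos (by positivity : 0 < 2 * omegaS n)] at key
  have k2 : (2 * omegaS n) * |∫ τ, P τ * l τ| ≤
      (2 * omegaS n) * (1 / 2 * (1 / (2 * omegaS n) * M) * L1norm n (Metric.ball 0 R) f) := by
    refine key.trans (le_of_eq ?_)
    field_simp
  exact le_of_mul_le_mul_left k2 (by positivity)

lemma ae_abs_radial_le (hn : 2 ≤ n) (ha : 0 < a) (haR : a ≤ R ^ 2) (hR : 0 < R)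
    (huf : MemW21Delta0 n (Metric.ball 0 R) u f) (hug : ∀ x, u x = g ‖x‖) :
    ∀ᵐ τ, |(Set.Ioo a (R ^ 2)).indicator (fun τ => g (Real.sqrt τ)) τ| ≤
      1 / 2 * (1 / (2 * omegaS n) * ∫ s in a..(R ^ 2), s ^ (-((n : ℝ) / 2))) *
        L1norm n (Metric.ball 0 R) f := by
  set P := (Set.Ioo a (R ^ 2)).indicator fun τ => g (Real.sqrt τ) with hP
  set C := 1 / 2 * (1 / (2 * omegaS n) * ∫ s in a..(R ^ 2), s ^ (-((n : ℝ) / 2))) *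
    L1norm n (Metric.ball 0 R) f with hC
  have iP : Integrable P := integrable_indicator_radial hn ha hR huf.1 hug
  let φ : ℕ → ContDiffBump (0 : ℝ) := fun i =>
    ⟨1 / ((i : ℝ) + 1) / 2, 1 / ((i : ℝ) + 1), by positivity, half_lt_self (by positivity)⟩
  have φr : Tendsto (fun i => (φ i).rOut) atTop (𝓝 0) := tendsto_one_div_add_atTop_nhds_zero_nat
  have leb := ContDiffBump.ae_convolution_tendsto_right_of_locallyIntegrable (μ := volume)
    (φ := φ) (K := 2) φr (Eventually.of_forall fun i => by simp only [φ]; linarith)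
    iP.locallyIntegrable
  filter_upwards [leb] with x₀ hx₀
  have C0 : 0 ≤ C := by
    obtain ⟨l, s, p, z, i, e⟩ := exists_smooth_unit_bump (show a < a + 1 by linarith)
    exact (abs_nonneg _).trans (abs_integral_radial_mul_bump_le hn ha haR hR huf hug le_rfl
      (by linarith) s p z e)
  rcases le_or_gt x₀ a with h | h
  · rw [hP, Set.indicator_of_notMem (fun k => absurd k.1 (not_lt.2 h)), abs_zero]
    exact C0
  · refine le_of_tendsto hx₀.abs ?_
    filter_upwards [φr.eventually_lt_const (show 0 < x₀ - a by linarith)] with i hi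
    rw [convolution_eq_swap]
    have e : ∫ t, (ContinuousLinearMap.lsmul ℝ ℝ) ((φ i).normed volume (x₀ - t)) (P t) =
        ∫ τ, P τ * (φ i).normed volume (x₀ - τ) := by
      refine integral_congr_ae (Eventually.of_forall fun t => ?_)
      simp [mul_comm]
    rw [e]
    refine abs_integral_radial_mul_bump_le hn ha haR hR huf hug (p := x₀ - (φ i).rOut)
      (q := x₀ + (φ i).rOut) (by linarith) (by linarith [(φ i).rOut_pos])
      ((φ i).contDiff_normed.comp (contDiff_const.sub contDiff_id)) (fun x => (φ i).nonneg_normed _)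
      (fun x hx => ?_) ?_
    · have : x₀ - x ∉ Function.support ((φ i).normed volume) := by
        rw [(φ i).support_normed_eq, Real.ball_eq_Ioo]
        intro h
        exact hx ⟨by linarith [h.2], by linarith [h.1]⟩
      simpa using this
    · rw [integral_sub_left_eq_self (fun x => (φ i).normed volume x)]
      exact (φ i).integral_normed

lemma decRearr_le_of_radial (hn : 2 ≤ n) {r : ℝ} (hr : 0 < r) (hrR : r ≤ R)
    (huf : MemW21Delta0 n (Metric.ball 0 R) u f) (hug : ∀ x, u x = g ‖x‖) :
    decRearr n (Metric.ball 0 R) u (volume (Metric.ball (0 : Euc n) r)).toReal ≤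
      1 / 2 * NstarV n (volume (Metric.ball (0 : Euc n) R)).toReal
        (volume (Metric.ball (0 : Euc n) r)).toReal * L1norm n (Metric.ball 0 R) f := by
  have hR := hr.trans_le hrR
  have : Nonempty (Fin n) := ⟨⟨0, by omega⟩⟩
  rw [toReal_volume_ball hn hR.le, toReal_volume_ball hn hr.le, NstarV_eq_integral hn rfl hr hR,
    ← toReal_volume_ball hn hr.le]
  have a0 : 0 < r ^ 2 := by positivity
  have ae := ae_abs_radial_le hn a0 (by gcongr) hR huf hug
  set P := (Set.Ioo (r ^ 2) (R ^ 2)).indicator fun τ => g (Real.sqrt τ) with hP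
  set C := 1 / 2 * (1 / (2 * omegaS n) * ∫ s in (r ^ 2)..(R ^ 2), s ^ (-((n : ℝ) / 2))) *
    L1norm n (Metric.ball 0 R) f with hC
  have C0 : 0 ≤ C := by
    obtain ⟨τ, hτ⟩ := ae.exists
    exact (abs_nonneg _).trans hτ
  refine decRearr_le_of_forall_lt C0 fun s hs => ?_
  rw [ENNReal.ofReal_toReal measure_ball_lt_top.ne]
  set G : ℝ → ℝ := fun τ => max (|P τ| - C) 0 with hG
  have G0 : G =ᵐ[volume.restrict (Set.Ioi 0)] fun _ => (0 : ℝ) :=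
    ae_restrict_of_ae (ae.mono fun τ hτ => max_eq_right (by linarith))
  have iG : IntegrableOn G (Set.Ioi 0) := (integrable_zero ℝ ℝ _).congr G0.symm
  have zero : ∫ x : Euc n, (‖x‖ ^ 2) ^ (1 - (n : ℝ) / 2) * G (‖x‖ ^ 2) = 0 := by
    rw [integral_rpow_mul_comp_norm_sq hn, integral_congr_ae G0]
    simp
  rw [integral_eq_zero_iff_of_nonneg (fun x => mul_nonneg (by positivity) (le_max_right _ _))
    ((integrable_rpow_mul_comp_norm_sq hn).2 iG)] at zero
  rw [← Measure.addHaar_closedBall_eq_addHaar_ball volume (0 : Euc n) r]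
  refine measure_mono_ae ?_
  filter_upwards [zero] with x hx h
  obtain ⟨hB, hsx⟩ := h
  rw [mem_ball_zero_iff] at hB
  by_contra hxr
  replace hxr : r < ‖x‖ := by
    rw [← not_le, ← mem_closedBall_zero_iff]
    exact hxr
  have hm : ‖x‖ ^ 2 ∈ Set.Ioo (r ^ 2) (R ^ 2) := ⟨by gcongr, by gcongr⟩
  have e : P (‖x‖ ^ 2) = u x := by
    rw [hP, Set.indicator_of_mem hm, Real.sqrt_sq (norm_nonneg _), hug]
  have x0 : 0 < ‖x‖ := hr.trans hxr
  have p1 : 0 < (‖x‖ ^ 2) ^ (1 - (n : ℝ) / 2) := by positivity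
  have p2 : 0 < G (‖x‖ ^ 2) := lt_max_of_lt_left (by rw [e]; linarith)
  exact (mul_pos p1 p2).ne' hx

end radial

lemma le_decRearr_of_lt {n : ℕ} {Ω : Set (Euc n)} {u : Euc n → ℝ} {t c C : ℝ}
    (hC : ∀ x, |u x| ≤ C) (hc : ∀ s, 0 ≤ s → s < c → ENNReal.ofReal t < volume {x ∈ Ω | s < |u x|}) :
    c ≤ decRearr n Ω u t := by
  refine le_csInf ⟨max C 0, le_max_right _ _, ?_⟩ fun s hs => ?_
  · have : {x ∈ Ω | max C 0 < |u x|} = ∅ :=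
      Set.eq_empty_of_forall_notMem fun x hx =>
        absurd hx.2 (not_lt.2 ((hC x).trans (le_max_left _ _)))
    rw [this, measure_empty]
    exact zero_le
  · by_contra! h
    exact absurd hs.2 (not_le.2 (hc s hs.1 h))

lemma IsTestFun.memW21Delta0 {n : ℕ} {Ω : Set (Euc n)} {φ : Euc n → ℝ} (h : IsTestFun n Ω φ) :
    MemW21Delta0 n Ω φ (lapl n φ) :=
  ⟨h.integrable.integrableOn, h.integrable_lapl.integrableOn, fun _ => φ, fun _ => h,
    by simp, by simp⟩

lemma L1norm_nonneg (n : ℕ) (Ω : Set (Euc n)) (f : Euc n → ℝ) : 0 ≤ L1norm n Ω f :=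
  integral_nonneg fun _ => abs_nonneg _

/-- Smooth truncations of the Green function with values in any class `Q` containing the
nonnegative radial functions attain the extremal ratio asymptotically. -/
lemma sSup_ratio_eq {n : ℕ} (hn : 2 ≤ n) {R : ℝ} (hR : 0 < R) {r : ℝ} (hr : 0 < r) (hrR : r ≤ R)
    {Q : (Euc n → ℝ) → Prop}
    (hQ : ∀ U : ℝ → ℝ, (∀ x : Euc n, 0 ≤ U (‖x‖ ^ 2)) → Q fun x => U (‖x‖ ^ 2))
    (upper : ∀ u f, MemW21Delta0 n (Metric.ball 0 R) u f → Q u →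
      decRearr n (Metric.ball 0 R) u (volume (Metric.ball (0 : Euc n) r)).toReal ≤
        1 / 2 * NstarV n (volume (Metric.ball (0 : Euc n) R)).toReal
          (volume (Metric.ball (0 : Euc n) r)).toReal * L1norm n (Metric.ball 0 R) f) :
    sSup {q : ℝ | ∃ u f : Euc n → ℝ, MemW21Delta0 n (Metric.ball 0 R) u f ∧ Q u ∧
      L1norm n (Metric.ball 0 R) f ≠ 0 ∧
      q = decRearr n (Metric.ball 0 R) u (volume (Metric.ball (0 : Euc n) r)).toReal /
        L1norm n (Metric.ball 0 R) f} =
      1 / 2 * NstarV n (volume (Metric.ball (0 : Euc n) R)).toReal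
          (volume (Metric.ball (0 : Euc n) r)).toReal := by
  have : Nonempty (Fin n) := ⟨⟨0, by omega⟩⟩
  set t := (volume (Metric.ball (0 : Euc n) r)).toReal with ht
  set N := 1 / 2 * NstarV n (volume (Metric.ball (0 : Euc n) R)).toReal t with hN
  set S := {q : ℝ | ∃ u f : Euc n → ℝ, MemW21Delta0 n (Metric.ball 0 R) u f ∧ Q u ∧
      L1norm n (Metric.ball 0 R) f ≠ 0 ∧
      q = decRearr n (Metric.ball 0 R) u t / L1norm n (Metric.ball 0 R) f} with hS
  have ω0 := omegaS_pos hn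
  have Ne : N = 1 / (4 * omegaS n) * ∫ s in (r ^ 2)..(R ^ 2), s ^ (-((n : ℝ) / 2)) := by
    rw [hN, ht, toReal_volume_ball hn hR.le, toReal_volume_ball hn hr.le,
      NstarV_eq_integral hn rfl hr hR]
    field_simp
    ring
  have r2 : 0 < r ^ 2 := by positivity
  have ii : ∀ {a b : ℝ}, 0 < a → 0 < b →
      IntervalIntegrable (fun s : ℝ => s ^ (-((n : ℝ) / 2))) volume a b := fun ha hb =>
    intervalIntegral.intervalIntegrable_rpow (Or.inr fun h =>
      absurd ((lt_min ha hb).trans_le h.1) (lt_irrefl _))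
  have N0 : 0 ≤ N := by
    rw [Ne]
    have : 0 ≤ ∫ s in (r ^ 2)..(R ^ 2), s ^ (-((n : ℝ) / 2)) :=
      intervalIntegral.integral_nonneg (by gcongr) fun s hs =>
        Real.rpow_nonneg (r2.le.trans hs.1) _
    positivity
  have ub : ∀ q ∈ S, q ≤ N := by
    rintro q ⟨u, f, huf, hq, h0, rfl⟩
    rw [div_le_iff₀ ((L1norm_nonneg _ _ _).lt_of_ne' h0)]
    exact upper u f huf hq
  refine le_antisymm (Real.sSup_le ub N0) ?_
  have Spos : 0 ≤ sSup S := Real.sSup_nonneg fun q => by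
    rintro ⟨u, f, huf, hq, h0, rfl⟩
    exact div_nonneg (decRearr_nonneg _ _ _ _) (L1norm_nonneg _ _ _)
  rcases hrR.eq_or_lt with rfl | hlt
  · rw [Ne, intervalIntegral.integral_same, mul_zero]
    exact Spos
  have lower : ∀ a b : ℝ, r ^ 2 < a → a < b → b < R ^ 2 →
      1 / (4 * omegaS n) * ∫ s in a..b, s ^ (-((n : ℝ) / 2)) ≤ sSup S := by
    intro a b hra hab hb
    have a0 : 0 < a := r2.trans hra
    obtain ⟨U, hU, U0, Ua, Ul⟩ := exists_radial_testFun hn hR a0 hab hb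
    set Φ := ∫ s in a..b, s ^ (-((n : ℝ) / 2)) with hΦ
    have Φ0 : 0 < Φ := intervalIntegral.intervalIntegral_pos_of_pos_on
      (ii a0 (a0.trans hab)) (fun s hs => Real.rpow_pos_of_pos (a0.trans hs.1) _) hab
    obtain ⟨C, hC⟩ := hU.2.1.exists_bound_of_continuous hU.1.continuous
    have dec : Φ ≤ decRearr n (Metric.ball 0 R) (fun x => U (‖x‖ ^ 2)) t := by
      refine le_decRearr_of_lt hC fun s _ hs => ?_
      rw [ht, ENNReal.ofReal_toReal measure_ball_lt_top.ne]
      have rs : r < Real.sqrt a := Real.lt_sqrt_of_sq_lt hra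
      have sR : Real.sqrt a ≤ R := Real.sqrt_le_iff.2 ⟨hR.le, (hab.trans hb).le⟩
      have lt : volume (Metric.ball (0 : Euc n) r) < volume (Metric.ball (0 : Euc n) √a) := by
        rw [← ENNReal.toReal_lt_toReal measure_ball_lt_top.ne measure_ball_lt_top.ne,
          toReal_volume_ball hn hr.le, toReal_volume_ball hn (Real.sqrt_nonneg _)]
        have : 0 < (volume (Metric.ball (0 : Euc n) 1)).toReal :=
          ENNReal.toReal_pos (Metric.measure_ball_pos _ _ one_pos).ne' measure_ball_lt_top.ne
        have : n ≠ 0 := by omega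
        gcongr
      refine lt.trans_le (measure_mono fun x hx => ⟨Metric.ball_subset_ball sR hx, ?_⟩)
      rw [mem_ball_zero_iff, Real.lt_sqrt (norm_nonneg _)] at hx
      exact (hs.trans_le (Ua x hx.le)).trans_le (le_abs_self _)
    have L4 : L1norm n (Metric.ball 0 R) (lapl n fun x => U (‖x‖ ^ 2)) ≤ 4 * omegaS n := by
      rw [L1norm, hU.setIntegral_abs_lapl]
      exact Ul
    have Lp : 0 < L1norm n (Metric.ball 0 R) (lapl n fun x => U (‖x‖ ^ 2)) := by
      refine (L1norm_nonneg _ _ _).lt_of_ne' fun h => ?_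
      have := upper _ _ hU.memW21Delta0 (hQ U U0)
      rw [h, mul_zero] at this
      linarith
    refine le_trans ?_ (le_csSup ⟨N, ub⟩ ⟨_, _, hU.memW21Delta0, hQ U U0, Lp.ne', rfl⟩)
    rw [one_div_mul_eq_div]
    exact div_le_div₀ (decRearr_nonneg _ _ _ _) dec Lp L4
  have cont : ∀ {a b : ℝ}, 0 < a → 0 < b →
      ContinuousAt (fun τ => ∫ s in a..τ, s ^ (-((n : ℝ) / 2))) b := fun {a b} ha hb =>
    (intervalIntegral.integral_hasDerivAt_right (ii ha hb)
      (ContinuousAt.stronglyMeasurableAtFilter isOpen_Ioi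
        (fun x hx => Real.continuousAt_rpow_const _ _ (Or.inl (ne_of_gt hx))) b hb)
      (Real.continuousAt_rpow_const _ _ (Or.inl hb.ne'))).continuousAt
  have rR2 : r ^ 2 < R ^ 2 := by gcongr
  have step : ∀ a : ℝ, r ^ 2 < a → a < R ^ 2 →
      1 / (4 * omegaS n) * ∫ s in a..(R ^ 2), s ^ (-((n : ℝ) / 2)) ≤ sSup S := by
    intro a hra haR
    refine le_of_tendsto (f := fun b => 1 / (4 * omegaS n) * ∫ s in a..b, s ^ (-((n : ℝ) / 2)))
      (x := 𝓝[<] (R ^ 2))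
      (((cont (r2.trans hra) (by positivity)).tendsto.mono_left nhdsWithin_le_nhds).const_mul _) ?_
    filter_upwards [Ioo_mem_nhdsLT haR] with b hb
    exact lower a b hra hb.1 hb.2
  rw [Ne, intervalIntegral.integral_symm]
  refine le_of_tendsto
    (f := fun a => 1 / (4 * omegaS n) * -∫ s in (R ^ 2)..a, s ^ (-((n : ℝ) / 2)))
    (x := 𝓝[>] (r ^ 2))
    (((cont (by positivity) r2).tendsto.mono_left nhdsWithin_le_nhds).neg.const_mul _) ?_
  filter_upwards [Ioo_mem_nhdsGT rR2] with a ha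
  rw [← intervalIntegral.integral_symm]
  exact step a ha.1 ha.2

/-- For an open ball B ⊆ ℝⁿ (n ≥ 2) centered at the origin and each fixed
0 < t ≤ |B|, the supremum of u*(t)/‖Δu‖₁ over radial u ∈ W^{2,1}_{Δ,0}(B) with Δu ≠ 0
equals (1/2) N*_{|B|}(t); the same supremum over nonnegative u ∈ W^{2,1}_{Δ,0}(B) with
Δu ≠ 0 also equals (1/2) N*_{|B|}(t). -/
theorem stmt_7 (n : ℕ) (hn : 2 ≤ n) (R : ℝ) (hR : 0 < R)
    (t : ℝ) (ht : 0 < t) (ht' : t ≤ (volume (Metric.ball (0 : Euc n) R)).toReal) :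
    sSup {r : ℝ | ∃ u f : Euc n → ℝ,
      MemW21Delta0 n (Metric.ball (0 : Euc n) R) u f ∧
      (∃ g : ℝ → ℝ, ∀ x, u x = g ‖x‖) ∧
      L1norm n (Metric.ball (0 : Euc n) R) f ≠ 0 ∧
      r = decRearr n (Metric.ball (0 : Euc n) R) u t / L1norm n (Metric.ball (0 : Euc n) R) f}
      = (1 / 2) * NstarV n (volume (Metric.ball (0 : Euc n) R)).toReal t ∧
    sSup {r : ℝ | ∃ u f : Euc n → ℝ,
      MemW21Delta0 n (Metric.ball (0 : Euc n) R) u f ∧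
      (∀ᵐ x ∂(volume.restrict (Metric.ball (0 : Euc n) R)), 0 ≤ u x) ∧
      L1norm n (Metric.ball (0 : Euc n) R) f ≠ 0 ∧
      r = decRearr n (Metric.ball (0 : Euc n) R) u t / L1norm n (Metric.ball (0 : Euc n) R) f}
      = (1 / 2) * NstarV n (volume (Metric.ball (0 : Euc n) R)).toReal t := by
  have : Nonempty (Fin n) := ⟨⟨0, by omega⟩⟩
  obtain ⟨r, hr, hrR, rfl⟩ : ∃ r, 0 < r ∧ r ≤ R ∧
      (volume (Metric.ball (0 : Euc n) r)).toReal = t := by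
    have n0 : n ≠ 0 := by omega
    have β0 : 0 < (volume (Metric.ball (0 : Euc n) 1)).toReal :=
      ENNReal.toReal_pos (Metric.measure_ball_pos _ _ one_pos).ne' measure_ball_lt_top.ne
    set β := (volume (Metric.ball (0 : Euc n) 1)).toReal
    have hr : 0 < (t / β) ^ ((n : ℝ)⁻¹) := by positivity
    have e : ((t / β) ^ ((n : ℝ)⁻¹)) ^ n = t / β := Real.rpow_inv_natCast_pow (by positivity) n0
    refine ⟨(t / β) ^ ((n : ℝ)⁻¹), hr, ?_, ?_⟩
    · rw [← pow_le_pow_iff_left₀ hr.le hR.le n0, e, div_le_iff₀' β0,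
        ← toReal_volume_ball hn hR.le]
      exact ht'
    · rw [toReal_volume_ball hn hr.le, e, mul_div_cancel₀ _ β0.ne']
  constructor
  · refine sSup_ratio_eq hn hR hr hrR (Q := fun u => ∃ g : ℝ → ℝ, ∀ x, u x = g ‖x‖)
      (fun U _ => ⟨fun s => U (s ^ 2), fun _ => rfl⟩) fun u f huf ⟨g, hg⟩ => ?_
    exact decRearr_le_of_radial hn hr hrR huf hg
  · refine sSup_ratio_eq hn hR hr hrR
      (Q := fun u => ∀ᵐ x ∂(volume.restrict (Metric.ball (0 : Euc n) R)), 0 ≤ u x)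
      (fun U hU => Eventually.of_forall hU) fun u f huf hu => ?_
    exact decRearr_le_of_nonneg hn measurableSet_ball measure_ball_lt_top.ne huf hu ht ht'
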